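/- arXiv:1909.01833 — 2 statements merged into one kernel-verified Lean document; each statement's English description precedes it below -/
import Mathlib

section
/- The ternary quadratic form x² + y² + 2z² is strongly s-regular: for every positive integer n = n₁n₂ with n₁ a power of 2 and n₂ odd, r(n₁²n₂², f) = r(n₁², f) · ∏_{p | n₂} h_p(ord_p(n₂)). -/
open Finset

/-- The value of the diagonal ternary form `a x² + b y² + c z²`. -/
def tVal (a b c : ℤ) (v : ℤ × ℤ × ℤ) : ℤ :=
  a * v.1 ^ 2 + b * v.2.1 ^ 2 + c * v.2.2 ^ 2

/-- The number of representations of `n` by the diagonal ternary form `a x² + b y² + c z²`. -/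
noncomputable def tRep (a b c n : ℤ) : ℕ :=
  Set.ncard {v : ℤ × ℤ × ℤ | tVal a b c v = n}

/-- The local factor `h_p(μ)` for a diagonal ternary form `a x² + b y² + c z²`. -/
def tHp (a b c : ℤ) (p : ℕ) (μ : ℕ) : ℤ :=
  ((p : ℤ) ^ (μ + 1) - 1) / ((p : ℤ) - 1) -
    jacobiSym (-(a * b * c)) p * (((p : ℤ) ^ μ - 1) / ((p : ℤ) - 1))

/-- The number of representations of `N` by the binary form `x² + D y²`. -/
noncomputable def binRep (D : ℤ) (N : ℕ) : ℕ :=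
  Set.ncard {v : ℤ × ℤ | v.1 ^ 2 + D * v.2 ^ 2 = N}

/-- The divisor sum `∑_{d ∣ N} χ(d)`. -/
def charDivisorSum (χ : ℕ →* ℤ) (N : ℕ) : ℤ := ∑ d ∈ N.divisors, χ d

theorem charDivisorSum_prime_mul (χ : ℕ →* ℤ) {p N : ℕ} (hp : p.Prime) (hN : 0 < N) :
    charDivisorSum χ (p * N) = (1 + χ p) * charDivisorSum χ N -
      χ p * (if p ∣ N then charDivisorSum χ (N / p) else 0) := by
  have himg (M : ℕ) : ∑ d ∈ M.divisors.image (p * ·), χ d = χ p * charDivisorSum χ M := by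
    rw [sum_image (fun a _ b _ h => Nat.eq_of_mul_eq_mul_left hp.pos h), charDivisorSum, mul_sum]
    simp
  have hunion : (p * N).divisors = N.divisors ∪ N.divisors.image (p * ·) := by
    ext d
    simp only [Nat.mem_divisors, mem_union, mem_image]
    constructor
    · rintro ⟨hd, -⟩
      by_cases hpd : p ∣ d
      · obtain ⟨e, rfl⟩ := hpd
        exact Or.inr ⟨e, ⟨Nat.dvd_of_mul_dvd_mul_left hp.pos hd, hN.ne'⟩, rfl⟩
      · exact Or.inl ⟨((hp.coprime_iff_not_dvd.2 hpd).symm.dvd_of_dvd_mul_left hd), hN.ne'⟩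
    · rintro (⟨h, -⟩ | ⟨e, ⟨h, -⟩, rfl⟩)
      · exact ⟨h.mul_left p, (Nat.mul_pos hp.pos hN).ne'⟩
      · exact ⟨Nat.mul_dvd_mul_left p h, (Nat.mul_pos hp.pos hN).ne'⟩
  have hinter : ∑ d ∈ N.divisors ∩ N.divisors.image (p * ·), χ d =
      χ p * (if p ∣ N then charDivisorSum χ (N / p) else 0) := by
    split_ifs with h
    · obtain ⟨M, rfl⟩ := h
      have hM : 0 < M := Nat.pos_of_mul_pos_left hN
      rw [Nat.mul_div_cancel_left M hp.pos, ← himg M]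
      congr 1
      ext d
      simp only [Nat.mem_divisors, mem_inter, mem_image]
      constructor
      · rintro ⟨⟨h, -⟩, e, -, rfl⟩
        exact ⟨e, ⟨Nat.dvd_of_mul_dvd_mul_left hp.pos h, hM.ne'⟩, rfl⟩
      · rintro ⟨e, ⟨h, -⟩, rfl⟩
        exact ⟨⟨Nat.mul_dvd_mul_left p h, hN.ne'⟩, e, ⟨h.mul_left p, hN.ne'⟩, rfl⟩
    · rw [mul_zero]
      refine sum_eq_zero fun d hd => absurd ?_ h
      simp only [Nat.mem_divisors, mem_inter, mem_image] at hd
      obtain ⟨⟨h, -⟩, e, -, rfl⟩ := hd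
      exact (Dvd.intro _ rfl).trans h
  have := sum_union_inter (s₁ := N.divisors) (s₂ := N.divisors.image (p * ·)) (f := fun d => χ d)
  rw [← hunion, hinter, himg] at this
  simp only [charDivisorSum] at this ⊢
  linarith

theorem finite_binary {D : ℤ} (hD : 0 < D) (N : ℤ) :
    {v : ℤ × ℤ | v.1 ^ 2 + D * v.2 ^ 2 = N}.Finite := by
  refine ((Set.finite_Icc (-N) N).prod (Set.finite_Icc (-N) N)).subset ?_
  rintro ⟨x, y⟩ h
  simp only [Set.mem_ofPred_eq] at h
  have hy : y ^ 2 ≤ D * y ^ 2 := by nlinarith [sq_nonneg y]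
  have key (t : ℤ) (ht : t ^ 2 ≤ N) : t ∈ Set.Icc (-N) N := by
    constructor <;> nlinarith [Int.le_self_sq t, Int.le_self_sq (-t)]
  exact ⟨key x (by nlinarith), key y (by nlinarith [sq_nonneg x])⟩

/-- If `a² + D b² = p`, then multiplication by `a + b √-D` identifies the representations of `N`
with the representations of `p N` that are divisible by `a + b √-D`. -/
theorem ncard_binary_dvd {D a b : ℤ} {p : ℕ} (hp : p.Prime) (hab : a ^ 2 + D * b ^ 2 = p) (N : ℕ) :
    Set.ncard {v : ℤ × ℤ | v.1 ^ 2 + D * v.2 ^ 2 = (p * N : ℕ) ∧ (p : ℤ) ∣ a * v.2 - b * v.1} =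
      binRep D N := by
  have hp0 : (p : ℤ) ≠ 0 := by exact_mod_cast hp.ne_zero
  have hpp : Prime (p : ℤ) := Nat.prime_iff_prime_int.1 hp
  symm
  rw [binRep]
  refine Set.ncard_congr (fun v _ => (a * v.1 - D * b * v.2, a * v.2 + b * v.1)) ?_ ?_ ?_
  · rintro ⟨x, y⟩ h
    simp only [Set.mem_ofPred_eq] at h ⊢
    constructor
    · push_cast
      rw [← h, ← hab]
      ring
    · exact ⟨y, by rw [← hab]; ring⟩
  · rintro ⟨x, y⟩ ⟨x', y'⟩ - - h
    simp only [Prod.mk.injEq] at h ⊢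
    obtain ⟨h₁, h₂⟩ := h
    constructor <;> apply mul_left_cancel₀ hp0 <;> rw [← hab]
    · linear_combination a * h₁ + D * b * h₂
    · linear_combination a * h₂ - b * h₁
  · rintro ⟨x, y⟩ ⟨h, k, hk⟩
    simp only at h hk
    push_cast at h
    have hdvd : (p : ℤ) ∣ a * x + D * b * y := by
      refine hpp.dvd_of_dvd_pow (n := 2) ⟨p * N - D * p * k ^ 2, ?_⟩
      have : (a * x + D * b * y) ^ 2 + D * (a * y - b * x) ^ 2 = p * (p * N) := by
        rw [← h, ← hab]; ring
      rw [hk] at this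
      linear_combination this
    obtain ⟨l, hl⟩ := hdvd
    refine ⟨(l, k), ?_, ?_⟩
    · simp only [Set.mem_ofPred_eq]
      apply mul_left_cancel₀ (mul_ne_zero hp0 hp0)
      have : (a * x + D * b * y) ^ 2 + D * (a * y - b * x) ^ 2 = p * (p * N) := by
        rw [← h, ← hab]; ring
      rw [hk, hl] at this
      linear_combination this
    · simp only [Prod.mk.injEq]
      constructor <;> apply mul_left_cancel₀ hp0
      · linear_combination (-a) * hl + D * b * hk + x * hab
      · linear_combination (-a) * hk - b * hl + y * hab

theorem ncard_binary_dvd_both {D : ℤ} {p N : ℕ} (hp : p.Prime) :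
    Set.ncard {v : ℤ × ℤ | v.1 ^ 2 + D * v.2 ^ 2 = (p * N : ℕ) ∧ (p : ℤ) ∣ v.1 ∧ (p : ℤ) ∣ v.2} =
      if p ∣ N then binRep D (N / p) else 0 := by
  have hp0 : (p : ℤ) ≠ 0 := by exact_mod_cast hp.ne_zero
  split_ifs with h
  · obtain ⟨M, rfl⟩ := h
    rw [Nat.mul_div_cancel_left M hp.pos, binRep]
    symm
    refine Set.ncard_congr (fun v _ => (p * v.1, p * v.2)) ?_ ?_ ?_
    · rintro ⟨x, y⟩ h
      simp only [Set.mem_ofPred_eq] at h ⊢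
      refine ⟨?_, Dvd.intro _ rfl, Dvd.intro _ rfl⟩
      push_cast
      rw [← h]
      ring
    · rintro ⟨x, y⟩ ⟨x', y'⟩ - - h
      simpa [hp.ne_zero] using h
    · rintro ⟨x, y⟩ ⟨h, ⟨k, hk⟩, ⟨l, hl⟩⟩
      simp only at h hk hl
      subst hk hl
      refine ⟨(k, l), ?_, rfl⟩
      simp only [Set.mem_ofPred_eq]
      apply mul_left_cancel₀ (mul_ne_zero hp0 hp0)
      push_cast at h
      linear_combination h
  · convert Set.ncard_empty (ℤ × ℤ)
    ext ⟨x, y⟩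
    simp only [Set.mem_ofPred_eq, Set.mem_empty_iff_false, iff_false]
    rintro ⟨hN, ⟨k, rfl⟩, ⟨l, rfl⟩⟩
    apply h
    push_cast at hN
    rw [← Int.natCast_dvd_natCast]
    refine ⟨k ^ 2 + D * l ^ 2, ?_⟩
    apply mul_left_cancel₀ hp0
    linear_combination -hN

theorem binRep_mul_ramified {D a b : ℤ} {p : ℕ} (hp : p.Prime) (hab : a ^ 2 + D * b ^ 2 = p)
    (h : ∀ x y : ℤ, (p : ℤ) ∣ x ^ 2 + D * y ^ 2 → (p : ℤ) ∣ a * y - b * x) (N : ℕ) :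
    binRep D (p * N) = binRep D N := by
  rw [← ncard_binary_dvd hp hab N, binRep]
  congr 1
  ext ⟨x, y⟩
  simp only [Set.mem_ofPred_eq, iff_self_and]
  intro hN
  exact h x y ⟨N, by rw [hN]; push_cast; rfl⟩

theorem binRep_mul_inert {D : ℤ} {p : ℕ} (hp : p.Prime)
    (h : ∀ x y : ℤ, (p : ℤ) ∣ x ^ 2 + D * y ^ 2 → (p : ℤ) ∣ x ∧ (p : ℤ) ∣ y) (N : ℕ) :
    binRep D (p * N) = if p ∣ N then binRep D (N / p) else 0 := by
  rw [← ncard_binary_dvd_both hp, binRep]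
  congr 1
  ext ⟨x, y⟩
  simp only [Set.mem_ofPred_eq, iff_self_and]
  intro hN
  exact h x y ⟨N, by rw [hN]; push_cast; rfl⟩

theorem binRep_mul_split {D a b : ℤ} (hD : 0 < D) {p : ℕ} (hp : p.Prime) (hp2 : p ≠ 2)
    (hpD : ¬ (p : ℤ) ∣ D) (hab : a ^ 2 + D * b ^ 2 = p) (N : ℕ) :
    binRep D (p * N) + (if p ∣ N then binRep D (N / p) else 0) = 2 * binRep D N := by
  have hpp : Prime (p : ℤ) := Nat.prime_iff_prime_int.1 hp
  have hab' : a ^ 2 + D * (-b) ^ 2 = p := by rw [neg_sq, hab]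
  set A := {v : ℤ × ℤ | v.1 ^ 2 + D * v.2 ^ 2 = (p * N : ℕ) ∧ (p : ℤ) ∣ a * v.2 - b * v.1} with hA
  set B := {v : ℤ × ℤ | v.1 ^ 2 + D * v.2 ^ 2 = (p * N : ℕ) ∧ (p : ℤ) ∣ a * v.2 - (-b) * v.1}
    with hB
  have hfin := finite_binary hD (p * N : ℕ)
  have hAB := Set.ncard_union_add_ncard_inter A B (hfin.subset fun v h => h.1)
    (hfin.subset fun v h => h.1)
  rw [ncard_binary_dvd hp hab, ncard_binary_dvd hp hab', ← two_mul] at hAB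
  rw [← hAB, ← ncard_binary_dvd_both hp, binRep]
  have hb : ¬ (p : ℤ) ∣ b := by
    intro hb
    have ha : (p : ℤ) ∣ a := hpp.dvd_of_dvd_pow (n := 2) ((Int.dvd_iff_dvd_of_dvd_add
      (c := D * b ^ 2) ⟨1, by rw [hab, mul_one]⟩).2 ((dvd_pow hb two_ne_zero).mul_left D))
    obtain ⟨k, rfl⟩ := hb
    obtain ⟨l, rfl⟩ := ha
    refine hpp.not_isUnit (isUnit_of_dvd_one ⟨l ^ 2 + D * k ^ 2, ?_⟩)
    apply mul_left_cancel₀ hpp.ne_zero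
    linear_combination -hab
  have ha : ¬ (p : ℤ) ∣ a := by
    intro ha
    have := (Int.dvd_iff_dvd_of_dvd_add
      (c := D * b ^ 2) ⟨1, by rw [hab, mul_one]⟩).1 (dvd_pow ha two_ne_zero)
    exact (hpp.dvd_or_dvd this).elim hpD fun h => hb (hpp.dvd_of_dvd_pow h)
  have h2 : ¬ (p : ℤ) ∣ 2 := by
    intro h
    exact hp2 ((Nat.prime_dvd_prime_iff_eq hp Nat.prime_two).1 (by exact_mod_cast h))
  congr 2
  · ext ⟨x, y⟩
    simp only [hA, hB, Set.mem_ofPred_eq, Set.mem_union, ← and_or_left, iff_self_and]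
    intro hN
    apply hpp.dvd_or_dvd
    push_cast at hN
    exact ⟨y ^ 2 - b ^ 2 * N, by linear_combination y ^ 2 * hab - b ^ 2 * hN⟩
  · ext ⟨x, y⟩
    simp only [hA, hB, Set.mem_ofPred_eq, Set.mem_inter_iff, ← and_and_left,
      and_congr_right_iff]
    intro hN
    constructor
    · rintro ⟨hx, hy⟩
      exact ⟨dvd_sub (hy.mul_left a) (hx.mul_left b),
        dvd_sub (hy.mul_left a) (hx.mul_left (-b))⟩
    · rintro ⟨h₁, h₂⟩
      constructor
      · have : (p : ℤ) ∣ 2 * (b * x) := by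
          rw [show 2 * (b * x) = (a * y - -b * x) - (a * y - b * x) by ring]
          exact dvd_sub h₂ h₁
        exact ((hpp.dvd_or_dvd ((hpp.dvd_or_dvd this).resolve_left h2)).resolve_left hb)
      · have : (p : ℤ) ∣ 2 * (a * y) := by
          rw [show 2 * (a * y) = (a * y - -b * x) + (a * y - b * x) by ring]
          exact dvd_add h₂ h₁
        exact ((hpp.dvd_or_dvd ((hpp.dvd_or_dvd this).resolve_left h2)).resolve_left ha)

/-- A prime is ramified, split (with a generator of norm `p`), or inert in `ℤ[√-D]`,
as prescribed by `χ`. -/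
def SplittingLaw (D : ℤ) (χ : ℕ →* ℤ) (p : ℕ) : Prop :=
  (χ p = 0 ∧ ∃ a b : ℤ, a ^ 2 + D * b ^ 2 = p ∧
    ∀ x y : ℤ, (p : ℤ) ∣ x ^ 2 + D * y ^ 2 → (p : ℤ) ∣ a * y - b * x) ∨
  (χ p = 1 ∧ p ≠ 2 ∧ ¬ (p : ℤ) ∣ D ∧ ∃ a b : ℤ, a ^ 2 + D * b ^ 2 = p) ∨
  (χ p = -1 ∧ ∀ x y : ℤ, (p : ℤ) ∣ x ^ 2 + D * y ^ 2 → (p : ℤ) ∣ x ∧ (p : ℤ) ∣ y)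

theorem binRep_prime_mul {D : ℤ} (hD : 0 < D) {χ : ℕ →* ℤ} {p : ℕ} (hp : p.Prime)
    (h : SplittingLaw D χ p) (N : ℕ) :
    (binRep D (p * N) : ℤ) = (1 + χ p) * binRep D N -
      χ p * (if p ∣ N then (binRep D (N / p) : ℤ) else 0) := by
  rcases h with ⟨hχ, a, b, hab, h⟩ | ⟨hχ, hp2, hpD, a, b, hab⟩ | ⟨hχ, h⟩
  · rw [hχ, binRep_mul_ramified hp hab h]
    ring
  · have := binRep_mul_split hD hp hp2 hpD hab N
    rw [hχ]
    split_ifs at this ⊢ <;> zify at this <;> linarith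
  · rw [hχ, binRep_mul_inert hp h]
    push_cast
    ring

/-- **Dirichlet's formula** for the number of representations by a form of class number one. -/
theorem binRep_eq {D : ℤ} (hD : 0 < D) {χ : ℕ →* ℤ}
    (h : ∀ p : ℕ, p.Prime → SplittingLaw D χ p) {N : ℕ} (hN : 0 < N) :
    (binRep D N : ℤ) = binRep D 1 * charDivisorSum χ N := by
  induction N using Nat.strong_induction_on with
  | _ N ih =>
    rcases (Nat.one_le_iff_ne_zero.2 hN.ne').eq_or_lt with rfl | h1
    · simp [charDivisorSum]
    · obtain ⟨p, hp, M, rfl⟩ := Nat.exists_prime_and_dvd h1.ne'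
      have hM : 0 < M := Nat.pos_of_mul_pos_left hN
      have hMlt : M < p * M := by nlinarith [hp.two_le]
      rw [binRep_prime_mul hD hp (h p hp), charDivisorSum_prime_mul χ hp hM, ih M hMlt hM]
      split_ifs with hpM
      · rw [ih (M / p) ((Nat.div_le_self M p).trans_lt hMlt)
          (Nat.div_pos (Nat.le_of_dvd hM hpM) hp.pos)]
        ring
      · ring

/-- The nontrivial character modulo `4` as a function on `ℕ`. -/
def chiFour : ℕ →* ℤ := ZMod.χ₄.toMonoidHom.comp (Nat.castRingHom (ZMod 4)).toMonoidHom

/-- The character `(-2 / ·)` modulo `8` as a function on `ℕ`. -/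
def chiEight : ℕ →* ℤ := ZMod.χ₈'.toMonoidHom.comp (Nat.castRingHom (ZMod 8)).toMonoidHom

theorem chiFour_apply (n : ℕ) : chiFour n = ZMod.χ₄ n := rfl

theorem chiEight_apply (n : ℕ) : chiEight n = ZMod.χ₈' n := rfl

theorem splittingLaw_one {p : ℕ} (hp : p.Prime) : SplittingLaw 1 chiFour p := by
  have := Fact.mk hp
  rcases hp.eq_two_or_odd with rfl | hodd
  · refine Or.inl ⟨rfl, 1, 1, by norm_num, fun x y h => ?_⟩
    have : (2 : ℤ) ∣ (1 * y - 1 * x) ^ 2 := by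
      have h' : (2 : ℤ) ∣ x ^ 2 + 1 * y ^ 2 := h
      rw [show (1 * y - 1 * x) ^ 2 = (x ^ 2 + 1 * y ^ 2) - 2 * (x * y) by ring]
      exact dvd_sub h' (Dvd.intro _ rfl)
    exact Int.prime_two.dvd_of_dvd_pow this
  · have hp2 : p ≠ 2 := by rintro rfl; simp at hodd
    have hcases : p % 4 = 1 ∨ p % 4 = 3 := by omega
    rcases hcases with h | h
    · refine Or.inr (Or.inl ⟨ZMod.χ₄_nat_one_mod_four h, hp2, ?_, ?_⟩)
      · exact fun hd => hp.one_lt.ne' (Nat.dvd_one.1 (by exact_mod_cast hd))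
      · obtain ⟨a, b, hab⟩ := Nat.Prime.sq_add_sq (p := p) (by omega)
        exact ⟨a, b, by rw [← hab]; push_cast; ring⟩
    · refine Or.inr (Or.inr ⟨ZMod.χ₄_nat_three_mod_four h, fun x y hxy => ?_⟩)
      refine legendreSym.prime_dvd_of_eq_neg_one (a := -1) ?_ (by convert hxy using 1; ring)
      rw [legendreSym.at_neg_one hp2]
      exact ZMod.χ₄_nat_three_mod_four h

/-- A prime modulo which `-2` is a square is of the form `a² + 2 b²`. -/
theorem exists_sq_add_two_mul_sq {p : ℕ} (hp : p.Prime) {t : ZMod p} (ht : t ^ 2 = -2) :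
    ∃ a b : ℤ, a ^ 2 + 2 * b ^ 2 = p := by
  have := Fact.mk hp
  set m := p.sqrt with hm
  have hm_lt : m * m < p := by
    refine (Nat.sqrt_le p).lt_of_ne fun h => ?_
    exact hp.prime.irreducible.not_isSquare ⟨_, h.symm⟩
  have hlt_m : p < (m + 1) * (m + 1) := Nat.lt_succ_sqrt p
  obtain ⟨u, hu, v, hv, huv, heq⟩ := exists_ne_map_eq_of_card_lt_of_maps_to
    (s := range (m + 1) ×ˢ range (m + 1)) (t := (univ : Finset (ZMod p)))
    (f := fun u => (u.1 : ZMod p) - t * u.2) (by simpa [ZMod.card] using hlt_m)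
    (fun _ _ => mem_coe.2 (mem_univ _))
  simp only [mem_product, mem_range] at hu hv
  set x : ℤ := (u.1 : ℤ) - v.1 with hx
  set y : ℤ := (u.2 : ℤ) - v.2 with hy
  have hx2 : x ^ 2 ≤ m * m := by
    rw [← sq]; exact sq_le_sq' (by omega) (by omega)
  have hy2 : y ^ 2 ≤ m * m := by
    rw [← sq]; exact sq_le_sq' (by omega) (by omega)
  have hpos : 0 < x ^ 2 + 2 * y ^ 2 := by
    by_contra hcon
    have hx0 : x = 0 := by nlinarith [sq_nonneg x, sq_nonneg y]
    have hy0 : y = 0 := by nlinarith [sq_nonneg x, sq_nonneg y]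
    exact huv (Prod.ext (by omega) (by omega))
  have hdvd : (p : ℤ) ∣ x ^ 2 + 2 * y ^ 2 := by
    rw [← ZMod.intCast_zmod_eq_zero_iff_dvd]
    have hxy : ((x : ℤ) : ZMod p) = t * (y : ℤ) := by
      simp only [hx, hy]
      push_cast
      linear_combination heq
    push_cast
    rw [hxy]
    linear_combination (y : ZMod p) ^ 2 * ht
  obtain ⟨k, hk⟩ := hdvd
  have hm_lt' : (m : ℤ) * m < p := by exact_mod_cast hm_lt
  have hp0 : (0 : ℤ) < p := by exact_mod_cast hp.pos
  have hk0 : 0 < k := by by_contra h; nlinarith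
  have hk3 : k < 3 := by by_contra h; nlinarith
  obtain rfl | rfl : k = 1 ∨ k = 2 := by omega
  · exact ⟨x, y, by linarith⟩
  · have : (2 : ℤ) ∣ x := Int.prime_two.dvd_of_dvd_pow (n := 2) ⟨p - y ^ 2, by linarith⟩
    obtain ⟨z, hz⟩ := this
    exact ⟨y, z, by rw [hz] at hk; linarith⟩

theorem splittingLaw_two {p : ℕ} (hp : p.Prime) : SplittingLaw 2 chiEight p := by
  have := Fact.mk hp
  rcases hp.eq_two_or_odd with rfl | hodd
  · refine Or.inl ⟨rfl, 0, 1, by norm_num, fun x y h => ?_⟩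
    have h' : (2 : ℤ) ∣ x ^ 2 + 2 * y ^ 2 := h
    have : (2 : ℤ) ∣ x := Int.prime_two.dvd_of_dvd_pow ((dvd_add_left (Dvd.intro _ rfl)).1 h')
    simpa using this
  · have hp2 : p ≠ 2 := by rintro rfl; simp at hodd
    have hleg := legendreSym.at_neg_two hp2
    rw [← chiEight_apply] at hleg
    have hp2' : ¬ (p : ℤ) ∣ 2 := fun h =>
      hp2 ((Nat.prime_dvd_prime_iff_eq hp Nat.prime_two).1 (by exact_mod_cast h))
    have h0 : ((-2 : ℤ) : ZMod p) ≠ 0 := by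
      rw [Ne, ZMod.intCast_zmod_eq_zero_iff_dvd, Int.dvd_neg]
      exact hp2'
    rcases legendreSym.eq_one_or_neg_one p h0 with h | h
    · refine Or.inr (Or.inl ⟨hleg ▸ h, hp2, hp2', ?_⟩)
      obtain ⟨t, ht⟩ := (legendreSym.eq_one_iff p h0).1 h
      exact exists_sq_add_two_mul_sq hp (t := t) (by rw [sq, ← ht]; push_cast; rfl)
    · exact Or.inr (Or.inr ⟨hleg ▸ h, fun x y hxy =>
        legendreSym.prime_dvd_of_eq_neg_one h (by convert hxy using 1; ring)⟩)

theorem binRep_one_one : binRep 1 1 = 4 := by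
  have : {v : ℤ × ℤ | v.1 ^ 2 + 1 * v.2 ^ 2 = (1 : ℕ)} =
      (({(1, 0), (-1, 0), (0, 1), (0, -1)} : Finset (ℤ × ℤ)) : Set (ℤ × ℤ)) := by
    ext ⟨x, y⟩
    simp only [Set.mem_ofPred_eq, Nat.cast_one, coe_insert, coe_singleton, Set.mem_insert_iff,
      Set.mem_singleton_iff, Prod.mk.injEq]
    constructor
    · intro h
      have hx : -1 ≤ x ∧ x ≤ 1 := by constructor <;> nlinarith [sq_nonneg y]
      have hy : -1 ≤ y ∧ y ≤ 1 := by constructor <;> nlinarith [sq_nonneg x]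
      obtain ⟨hx₁, hx₂⟩ := hx
      obtain ⟨hy₁, hy₂⟩ := hy
      interval_cases x <;> interval_cases y <;> simp_all
    · rintro (⟨rfl, rfl⟩ | ⟨rfl, rfl⟩ | ⟨rfl, rfl⟩ | ⟨rfl, rfl⟩) <;> norm_num
  rw [binRep, this, Set.ncard_coe_finset]
  rfl

theorem binRep_two_one : binRep 2 1 = 2 := by
  have : {v : ℤ × ℤ | v.1 ^ 2 + 2 * v.2 ^ 2 = (1 : ℕ)} =
      (({(1, 0), (-1, 0)} : Finset (ℤ × ℤ)) : Set (ℤ × ℤ)) := by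
    ext ⟨x, y⟩
    simp only [Set.mem_ofPred_eq, Nat.cast_one, coe_insert, coe_singleton, Set.mem_insert_iff,
      Set.mem_singleton_iff, Prod.mk.injEq]
    constructor
    · intro h
      have hx : -1 ≤ x ∧ x ≤ 1 := by constructor <;> nlinarith [sq_nonneg y]
      have hy : -1 ≤ y ∧ y ≤ 1 := by constructor <;> nlinarith [sq_nonneg x]
      obtain ⟨hx₁, hx₂⟩ := hx
      obtain ⟨hy₁, hy₂⟩ := hy
      interval_cases x <;> interval_cases y <;> simp_all
    · rintro (⟨rfl, rfl⟩ | ⟨rfl, rfl⟩) <;> norm_num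
  rw [binRep, this, Set.ncard_coe_finset]
  rfl

theorem binRep_two_zero : binRep 2 0 = 1 := by
  have : {v : ℤ × ℤ | v.1 ^ 2 + 2 * v.2 ^ 2 = (0 : ℕ)} = {(0, 0)} := by
    ext ⟨x, y⟩
    simp only [Set.mem_ofPred_eq, Nat.cast_zero, Set.mem_singleton_iff, Prod.mk.injEq]
    constructor
    · intro h
      constructor <;> nlinarith [sq_nonneg x, sq_nonneg y]
    · rintro ⟨rfl, rfl⟩
      norm_num
  rw [binRep, this, Set.ncard_singleton]

/-- **Jacobi's two-square theorem**. -/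
theorem binRep_one_eq {N : ℕ} (hN : 0 < N) : (binRep 1 N : ℤ) = 4 * charDivisorSum chiFour N := by
  rw [binRep_eq one_pos (fun p hp => splittingLaw_one hp) hN, binRep_one_one]
  rfl

theorem binRep_two_eq {N : ℕ} (hN : 0 < N) :
    (binRep 2 N : ℤ) = 2 * charDivisorSum chiEight N := by
  rw [binRep_eq two_pos (fun p hp => splittingLaw_two hp) hN, binRep_two_one]
  rfl

section DivisorPairs

variable {a u g w v : ℕ}

theorem gcd_div_of_coprime (ha : 0 < a) (huw : u.Coprime w) :
    (a * u * g / a).gcd (w * g) = g := by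
  rw [mul_assoc, Nat.mul_div_cancel_left _ ha, Nat.gcd_mul_right, huw, one_mul]

theorem gcd_mul_div_of_coprime (hg : 0 < g) (huw : u.Coprime w) :
    (a * w).gcd (a * u * g / g) = a := by
  rw [Nat.mul_div_cancel _ hg, Nat.gcd_mul_left, huw.symm, mul_one]

theorem exists_coprime_of_dvd_of_dvd {A B b : ℕ} (ha : a ∣ A) (hb : b ∣ B) :
    ∃ u g w v : ℕ, u.Coprime w ∧ A = a * u * g ∧ B = w * g * v ∧ b = w * g := by
  obtain ⟨a', rfl⟩ := ha
  obtain ⟨b', rfl⟩ := hb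
  obtain ⟨u, w, huw, hu, hw⟩ := Nat.exists_coprime a' b
  refine ⟨u, a'.gcd b, w, b', huw, ?_, ?_, hw⟩
  · rw [mul_assoc, ← hu]
  · rw [← hw]

theorem exists_coprime_of_dvd_mul {A B c : ℕ} (hA : g ∣ A) (hB : g ∣ B) (hg : 0 < g)
    (hc : c ∣ A / g * (B / g)) :
    ∃ a u w v : ℕ, u.Coprime w ∧ A = a * u * g ∧ B = w * g * v ∧ c = a * w := by
  obtain ⟨A, rfl⟩ := hA
  obtain ⟨B, rfl⟩ := hB
  rw [Nat.mul_div_cancel_left _ hg, Nat.mul_div_cancel_left _ hg] at hc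
  rcases Nat.eq_zero_or_pos (A.gcd c) with h0 | hpos
  · obtain ⟨rfl, rfl⟩ := Nat.gcd_eq_zero_iff.1 h0
    exact ⟨0, 1, 1, B, by simp, by simp, by ring, by simp⟩
  obtain ⟨u, w, huw, hu, hw⟩ := Nat.exists_coprime A c
  generalize A.gcd c = a at hu hw hpos
  subst hu hw
  have : w ∣ u * B := by
    refine Nat.dvd_of_mul_dvd_mul_right hpos (hc.trans (Dvd.intro 1 ?_))
    ring
  obtain ⟨v, rfl⟩ := huw.symm.dvd_of_dvd_mul_left this
  exact ⟨a, u, w, v, huw, by ring, by ring, by ring⟩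

end DivisorPairs

/-- The Hecke relation for divisor sums of a completely multiplicative function. -/
theorem charDivisorSum_mul (χ : ℕ →* ℤ) {A B : ℕ} (hA : 0 < A) (hB : 0 < B) :
    charDivisorSum χ A * charDivisorSum χ B =
      ∑ g ∈ (A.gcd B).divisors, χ g * charDivisorSum χ (A / g * (B / g)) := by
  rw [charDivisorSum, charDivisorSum, sum_mul_sum, ← sum_product']
  simp only [charDivisorSum, mul_sum, ← map_mul]
  rw [sum_sigma']
  refine sum_bij' (i := fun x _ => ⟨(A / x.1).gcd x.2, x.1 * x.2 / (A / x.1).gcd x.2⟩)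
    (j := fun y _ => (y.2.gcd (A / y.1), y.2 * y.1 / y.2.gcd (A / y.1))) ?_ ?_ ?_ ?_ ?_
  · rintro ⟨a, b⟩ h
    simp only [mem_product, Nat.mem_divisors] at h
    obtain ⟨u, g, w, v, huw, rfl, rfl, rfl⟩ := exists_coprime_of_dvd_of_dvd h.1.1 h.2.1
    have ha : 0 < a := Nat.pos_of_dvd_of_pos h.1.1 hA
    have hg : 0 < g := Nat.pos_of_mul_pos_left hA
    simp only [gcd_div_of_coprime ha huw, mem_sigma, Nat.mem_divisors]
    refine ⟨⟨Nat.dvd_gcd (Dvd.intro_left _ rfl) ⟨w * v, by ring⟩,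
      (Nat.gcd_pos_of_pos_left _ hA).ne'⟩, ?_, ?_⟩
    · rw [← mul_assoc, Nat.mul_div_cancel _ hg, Nat.mul_div_cancel _ hg,
        show w * g * v = w * v * g by ring, Nat.mul_div_cancel _ hg]
      exact ⟨u * v, by ring⟩
    · rw [Nat.mul_div_cancel _ hg, show w * g * v = w * v * g by ring, Nat.mul_div_cancel _ hg]
      intro h0
      rcases mul_eq_zero.1 h0 with h0 | h0
      · simp [h0] at hA
      · rw [show w * g * v = w * v * g by ring] at hB
        simp [h0] at hB
  · rintro ⟨g, c⟩ h
    simp only [mem_sigma, Nat.mem_divisors] at h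
    have hg : 0 < g := Nat.pos_of_dvd_of_pos (h.1.1.trans (Nat.gcd_dvd_left A B)) hA
    obtain ⟨a, u, w, v, huw, rfl, rfl, rfl⟩ := exists_coprime_of_dvd_mul
      (h.1.1.trans (Nat.gcd_dvd_left A B)) (h.1.1.trans (Nat.gcd_dvd_right A B)) hg h.2.1
    have ha : 0 < a := Nat.pos_of_ne_zero (by rintro rfl; simp at hA)
    simp only [gcd_mul_div_of_coprime hg huw, mem_product, Nat.mem_divisors]
    refine ⟨⟨⟨u * g, by ring⟩, hA.ne'⟩, ?_, hB.ne'⟩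
    rw [mul_assoc a, Nat.mul_div_cancel_left _ ha]
    exact Dvd.intro _ rfl
  · rintro ⟨a, b⟩ h
    simp only [mem_product, Nat.mem_divisors] at h
    obtain ⟨u, g, w, v, huw, rfl, rfl, rfl⟩ := exists_coprime_of_dvd_of_dvd h.1.1 h.2.1
    have ha : 0 < a := Nat.pos_of_dvd_of_pos h.1.1 hA
    have hg : 0 < g := Nat.pos_of_mul_pos_left hA
    simp only [gcd_div_of_coprime ha huw]
    rw [← mul_assoc, Nat.mul_div_cancel _ hg, gcd_mul_div_of_coprime hg huw, mul_assoc,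
      Nat.mul_div_cancel_left _ ha]
  · rintro ⟨g, c⟩ h
    simp only [mem_sigma, Nat.mem_divisors] at h
    have hg : 0 < g := Nat.pos_of_dvd_of_pos (h.1.1.trans (Nat.gcd_dvd_left A B)) hA
    obtain ⟨a, u, w, v, huw, rfl, rfl, rfl⟩ := exists_coprime_of_dvd_mul
      (h.1.1.trans (Nat.gcd_dvd_left A B)) (h.1.1.trans (Nat.gcd_dvd_right A B)) hg h.2.1
    have ha : 0 < a := Nat.pos_of_ne_zero (by rintro rfl; simp at hA)
    simp only [gcd_mul_div_of_coprime hg huw]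
    rw [mul_assoc a w g, Nat.mul_div_cancel_left _ ha, gcd_div_of_coprime ha huw, ← mul_assoc,
      Nat.mul_div_cancel _ hg]
  · rintro ⟨a, b⟩ h
    simp only [mem_product, Nat.mem_divisors] at h
    congr 1
    exact (Nat.mul_div_cancel' ((Nat.gcd_dvd_right _ _).mul_left _)).symm

/-- The Hecke relation for the number of representations by `x² + 2y²`, including `A = 0`. -/
theorem binRep_two_mul {A B : ℕ} (h : 0 < A + B) :
    (binRep 2 A * binRep 2 B : ℤ) =
      2 * ∑ g ∈ (A.gcd B).divisors, chiEight g * binRep 2 (A / g * (B / g)) := by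
  have hzero {M : ℕ} (hM : 0 < M) : (binRep 2 M : ℤ) = 2 * ∑ g ∈ M.divisors, chiEight g * 1 := by
    rw [binRep_two_eq hM, charDivisorSum]
    simp
  rcases Nat.eq_zero_or_pos A with rfl | hA
  · simpa [binRep_two_zero] using hzero (by simpa using h)
  rcases Nat.eq_zero_or_pos B with rfl | hB
  · simpa [binRep_two_zero] using hzero (by simpa using h)
  rw [binRep_two_eq hA, binRep_two_eq hB]
  have (g) (hg : g ∈ (A.gcd B).divisors) : chiEight g * (binRep 2 (A / g * (B / g)) : ℤ) =
      2 * (chiEight g * charDivisorSum chiEight (A / g * (B / g))) := by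
    have hg' := Nat.dvd_of_mem_divisors hg
    have hg0 := Nat.pos_of_mem_divisors hg
    rw [binRep_two_eq (Nat.mul_pos
      (Nat.div_pos (Nat.le_of_dvd hA (hg'.trans (Nat.gcd_dvd_left A B))) hg0)
      (Nat.div_pos (Nat.le_of_dvd hB (hg'.trans (Nat.gcd_dvd_right A B))) hg0))]
    ring
  rw [sum_congr rfl this, ← mul_sum, ← charDivisorSum_mul chiEight hA hB]
  ring

theorem chiFour_mul_of_odd {a b : ℕ} (ha : a % 2 = 1) (hb : b % 2 = 1) (hba : b ≤ a) :
    chiFour a * chiFour b = (-1) ^ ((a - b) / 2) := by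
  rw [chiFour_apply, chiFour_apply, ZMod.χ₄_eq_neg_one_pow ha, ZMod.χ₄_eq_neg_one_pow hb,
    show a / 2 = (a - b) / 2 + b / 2 by omega, pow_add, mul_assoc, ← mul_pow]
  simp

/-- The quadruples `(a, x, b, y)` of odd positive integers with `a x + b y = M`. -/
def oddQuadruples (M : ℕ) : Finset (ℕ × ℕ × ℕ × ℕ) :=
  {v ∈ range (M + 1) ×ˢ range (M + 1) ×ˢ range (M + 1) ×ˢ range (M + 1) |
    (v.1 % 2 = 1 ∧ v.2.1 % 2 = 1 ∧ v.2.2.1 % 2 = 1 ∧ v.2.2.2 % 2 = 1) ∧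
      v.1 * v.2.1 + v.2.2.1 * v.2.2.2 = M}

theorem mem_oddQuadruples {M a x b y : ℕ} :
    (a, x, b, y) ∈ oddQuadruples M ↔
      (a % 2 = 1 ∧ x % 2 = 1 ∧ b % 2 = 1 ∧ y % 2 = 1) ∧ a * x + b * y = M := by
  simp only [oddQuadruples, mem_filter, mem_product, mem_range, and_iff_right_iff_imp]
  rintro ⟨⟨ha, hx, hb, hy⟩, h⟩
  have h₁ : a ≤ a * x := Nat.le_mul_of_pos_right _ (by omega)
  have h₂ : x ≤ a * x := Nat.le_mul_of_pos_left _ (by omega)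
  have h₃ : b ≤ b * y := Nat.le_mul_of_pos_right _ (by omega)
  have h₄ : y ≤ b * y := Nat.le_mul_of_pos_left _ (by omega)
  omega

/-- Dirichlet's involution on the quadruples `(a, x, b, y)` with `b < a`. It exchanges the roles of
`a - b` and `x + y`. -/
def dirichletInvolution (v : ℕ × ℕ × ℕ × ℕ) : ℕ × ℕ × ℕ × ℕ :=
  (v.2.1 + (v.2.1 + v.2.2.2) * (v.2.2.1 / (v.1 - v.2.2.1) + 1), v.2.2.1 % (v.1 - v.2.2.1),
    v.2.1 + (v.2.1 + v.2.2.2) * (v.2.2.1 / (v.1 - v.2.2.1)),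
    (v.1 - v.2.2.1) - v.2.2.1 % (v.1 - v.2.2.1))

theorem dirichletInvolution_apply {d s q c x : ℕ} (hc : c < 2 * d) (hd : 0 < d) (hx : x < 2 * s) :
    dirichletInvolution (2 * d * q + c + 2 * d, x, 2 * d * q + c, 2 * s - x) =
      (2 * s * q + x + 2 * s, c, 2 * s * q + x, 2 * d - c) := by
  have h₁ : 2 * d * q + c + 2 * d - (2 * d * q + c) = 2 * d := by omega
  have h₂ : x + (2 * s - x) = 2 * s := by omega
  have h₃ : (2 * d * q + c) / (2 * d) = q := by
    rw [Nat.mul_add_div (by omega), Nat.div_eq_of_lt hc, add_zero]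
  have h₄ : (2 * d * q + c) % (2 * d) = c := by
    rw [Nat.mul_add_mod, Nat.mod_eq_of_lt hc]
  simp only [dirichletInvolution, h₁, h₂, h₃, h₄, Prod.mk.injEq, true_and, and_true]
  constructor <;> ring

/-- Dirichlet's sign-reversing involution kills the quadruples with `b < a`. -/
theorem sum_oddQuadruples_gt {m : ℕ} (hm : Odd m) :
    ∑ v ∈ oddQuadruples (2 * m) with v.2.2.1 < v.1, chiFour v.1 * chiFour v.2.2.1 = 0 := by
  have key {a x b y : ℕ} (h : (a, x, b, y) ∈ oddQuadruples (2 * m)) (hlt : b < a) :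
      ∃ d s q c : ℕ, 0 < d ∧ x < 2 * s ∧ c < 2 * d ∧ c % 2 = 1 ∧ Odd (d + s) ∧
        x % 2 = 1 ∧ b = 2 * d * q + c ∧ a = b + 2 * d ∧ y = 2 * s - x ∧ d * x + b * s = m := by
    obtain ⟨⟨ha, hx, hb, hy⟩, h⟩ := mem_oddQuadruples.1 h
    obtain ⟨d, rfl⟩ : ∃ d, a = b + 2 * d := ⟨(a - b) / 2, by omega⟩
    obtain ⟨s, hs⟩ : ∃ s, x + y = 2 * s := ⟨(x + y) / 2, by omega⟩
    have hd : 0 < d := by omega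
    have hdiv := Nat.div_add_mod b (2 * d)
    have hc : b % (2 * d) % 2 = 1 := by rw [Nat.mod_mul_right_mod]; exact hb
    have hsum : d * x + b * s = m := by nlinarith
    refine ⟨d, s, b / (2 * d), b % (2 * d), hd, by omega, Nat.mod_lt _ (by omega), hc, ?_, hx,
      hdiv.symm, rfl, by omega, hsum⟩
    rw [← hsum] at hm
    have hx' : Odd x := Nat.odd_iff.2 hx
    have hb' : Odd b := Nat.odd_iff.2 hb
    simpa [Nat.odd_add, Nat.odd_mul, hx', hb', Nat.even_mul, Nat.not_even_iff_odd.2 hb'] using hm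
  refine sum_involution (g := fun v _ => dirichletInvolution v) ?_ ?_ ?_ ?_
  · rintro ⟨a, x, b, y⟩ h
    simp only [mem_filter] at h
    obtain ⟨d, s, q, c, hd, hxs, hcd, hc, hds, hx, rfl, rfl, rfl, hsum⟩ := key h.1 h.2
    rw [dirichletInvolution_apply hcd hd hxs]
    have e₁ : 2 * d * q % 2 = 0 := by rw [mul_assoc]; exact Nat.mul_mod_right _ _
    have e₂ : 2 * s * q % 2 = 0 := by rw [mul_assoc]; exact Nat.mul_mod_right _ _
    simp only
    rw [chiFour_mul_of_odd (by omega) (by omega) (by omega),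
      chiFour_mul_of_odd (by omega) (by omega) (by omega),
      show (2 * d * q + c + 2 * d - (2 * d * q + c)) / 2 = d by omega,
      show (2 * s * q + x + 2 * s - (2 * s * q + x)) / 2 = s by omega]
    rcases Nat.even_or_odd d with hd' | hd'
    · rw [hd'.neg_one_pow, ((Nat.odd_add'.1 hds).2 hd').neg_one_pow]
      norm_num
    · rw [hd'.neg_one_pow, ((Nat.odd_add.1 hds).1 hd').neg_one_pow]
      norm_num
  · rintro ⟨a, x, b, y⟩ h - heq
    simp only [mem_filter] at h
    obtain ⟨d, s, q, c, hd, hxs, hcd, hc, hds, hx, rfl, rfl, rfl, hsum⟩ := key h.1 h.2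
    rw [dirichletInvolution_apply hcd hd hxs] at heq
    simp only [Prod.mk.injEq] at heq
    have : d = s := by omega
    subst this
    exact (Nat.not_odd_iff_even.2 ⟨d, rfl⟩) hds
  · rintro ⟨a, x, b, y⟩ h
    simp only [mem_filter] at h
    obtain ⟨d, s, q, c, hd, hxs, hcd, hc, hds, hx, rfl, rfl, rfl, hsum⟩ := key h.1 h.2
    rw [dirichletInvolution_apply hcd hd hxs, mem_filter, mem_oddQuadruples]
    have e₂ : 2 * s * q % 2 = 0 := by rw [mul_assoc]; exact Nat.mul_mod_right _ _
    refine ⟨⟨⟨by omega, by omega, by omega, by omega⟩, ?_⟩, by simp only; omega⟩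
    obtain ⟨e, he⟩ := Nat.exists_eq_add_of_lt hcd
    rw [show 2 * d - c = e + 1 by omega, ← hsum]
    zify at he ⊢
    linear_combination (-(2 * s * q + x : ℤ)) * he
  · rintro ⟨a, x, b, y⟩ h
    simp only [mem_filter] at h
    obtain ⟨d, s, q, c, hd, hxs, hcd, hc, hds, hx, rfl, rfl, rfl, hsum⟩ := key h.1 h.2
    rw [dirichletInvolution_apply hcd hd hxs, dirichletInvolution_apply hxs (by omega) hcd]

theorem sum_oddQuadruples_lt {m : ℕ} (hm : Odd m) :
    ∑ v ∈ oddQuadruples (2 * m) with v.1 < v.2.2.1, chiFour v.1 * chiFour v.2.2.1 = 0 := by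
  rw [← sum_oddQuadruples_gt hm]
  refine sum_bij' (i := fun v _ => (v.2.2.1, v.2.2.2, v.1, v.2.1))
    (j := fun v _ => (v.2.2.1, v.2.2.2, v.1, v.2.1)) ?_ ?_ ?_ ?_ ?_
  · rintro ⟨a, x, b, y⟩ h
    simp only [mem_filter, mem_oddQuadruples] at h ⊢
    omega
  · rintro ⟨a, x, b, y⟩ h
    simp only [mem_filter, mem_oddQuadruples] at h ⊢
    omega
  · intros; rfl
  · intros; rfl
  · intros; exact mul_comm _ _

theorem sum_oddQuadruples_eq {m : ℕ} (hm : Odd m) :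
    ∑ v ∈ oddQuadruples (2 * m) with v.1 = v.2.2.1, chiFour v.1 * chiFour v.2.2.1 =
      ArithmeticFunction.sigma 1 m := by
  have hcard : ((ArithmeticFunction.sigma 1 m : ℕ) : ℤ) =
      ∑ _z ∈ m.divisors.sigma (fun d => range (m / d)), (1 : ℤ) := by
    rw [ArithmeticFunction.sigma_eq_sum_div, sum_sigma]
    simp
  rw [hcard]
  refine sum_bij' (i := fun v _ => ⟨v.1, v.2.1 / 2⟩)
    (j := fun z _ => (z.1, 2 * z.2 + 1, z.1, 2 * (m / z.1) - (2 * z.2 + 1))) ?_ ?_ ?_ ?_ ?_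
  · rintro ⟨a, x, b, y⟩ h
    simp only [mem_filter, mem_oddQuadruples] at h
    obtain ⟨⟨⟨ha, hx, hb, hy⟩, h⟩, rfl⟩ := h
    obtain ⟨s, hs⟩ : ∃ s, x + y = 2 * s := ⟨(x + y) / 2, by omega⟩
    have hm' : m = a * s := by nlinarith
    subst hm'
    simp only [mem_sigma, Nat.mem_divisors, mem_range]
    rw [Nat.mul_div_cancel_left _ (by omega)]
    exact ⟨⟨Dvd.intro _ rfl, hm.pos.ne'⟩, by omega⟩
  · rintro ⟨d, k⟩ h
    simp only [mem_sigma, Nat.mem_divisors, mem_range] at h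
    obtain ⟨⟨⟨e, rfl⟩, h0⟩, hk⟩ := h
    have hd : 0 < d := Nat.pos_of_ne_zero (by rintro rfl; simp at h0)
    rw [Nat.mul_div_cancel_left _ hd] at hk
    simp only [mem_filter, mem_oddQuadruples, and_true]
    rw [Nat.mul_div_cancel_left _ hd]
    have hd' := Nat.odd_iff.1 (Nat.odd_mul.1 hm).1
    refine ⟨⟨hd', by omega, hd', by omega⟩, ?_⟩
    rw [← mul_add, show 2 * k + 1 + (2 * e - (2 * k + 1)) = 2 * e by omega]
    ring
  · rintro ⟨a, x, b, y⟩ h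
    simp only [mem_filter, mem_oddQuadruples] at h
    obtain ⟨⟨⟨ha, hx, hb, hy⟩, h⟩, rfl⟩ := h
    obtain ⟨s, hs⟩ : ∃ s, x + y = 2 * s := ⟨(x + y) / 2, by omega⟩
    have hm' : m = a * s := by nlinarith
    subst hm'
    simp only [Prod.mk.injEq, true_and]
    rw [Nat.mul_div_cancel_left _ (by omega)]
    omega
  · rintro ⟨d, k⟩ h
    simp only [Sigma.mk.injEq, heq_eq_eq, true_and]
    omega
  · rintro ⟨a, x, b, y⟩ h
    simp only [mem_filter, mem_oddQuadruples] at h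
    obtain ⟨⟨⟨ha, hx, hb, hy⟩, h⟩, rfl⟩ := h
    rw [chiFour_mul_of_odd ha ha le_rfl]
    simp

theorem sum_antidiagonal_charDivisorSum {m : ℕ} (hm : Odd m) :
    ∑ x ∈ antidiagonal (2 * m) with Odd x.1,
      charDivisorSum chiFour x.1 * charDivisorSum chiFour x.2 = ArithmeticFunction.sigma 1 m := by
  have hsplit : ∑ v ∈ oddQuadruples (2 * m), chiFour v.1 * chiFour v.2.2.1 =
      ArithmeticFunction.sigma 1 m := by
    rw [← sum_filter_add_sum_filter_not _ (fun v => v.1 = v.2.2.1), sum_oddQuadruples_eq hm,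
      ← sum_filter_add_sum_filter_not _ (fun v => v.1 < v.2.2.1), filter_filter, filter_filter]
    have h₁ : ∀ v ∈ oddQuadruples (2 * m), (¬ v.1 = v.2.2.1 ∧ v.1 < v.2.2.1 ↔ v.1 < v.2.2.1) := by
      intros; omega
    have h₂ : ∀ v ∈ oddQuadruples (2 * m),
        (¬ v.1 = v.2.2.1 ∧ ¬ v.1 < v.2.2.1 ↔ v.2.2.1 < v.1) := by
      intros; omega
    rw [filter_congr h₁, filter_congr h₂, sum_oddQuadruples_lt hm, sum_oddQuadruples_gt hm]
    simp
  rw [← hsplit]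
  simp only [charDivisorSum, sum_mul_sum, ← sum_product']
  rw [sum_sigma']
  refine sum_bij' (i := fun z _ => (z.2.1, z.1.1 / z.2.1, z.2.2, z.1.2 / z.2.2))
    (j := fun v _ => ⟨(v.1 * v.2.1, v.2.2.1 * v.2.2.2), (v.1, v.2.2.1)⟩) ?_ ?_ ?_ ?_ ?_
  · rintro ⟨⟨A, B⟩, a, b⟩ h
    simp only [mem_sigma, mem_filter, HasAntidiagonal.mem_antidiagonal, mem_product,
      Nat.mem_divisors] at h
    obtain ⟨⟨hAB, hA⟩, ⟨⟨x, rfl⟩, hA0⟩, ⟨y, rfl⟩, hB0⟩ := h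
    have hB : Odd (b * y) := by
      have := Nat.odd_iff.1 hA
      exact Nat.odd_iff.2 (by omega)
    obtain ⟨ha, hx⟩ := Nat.odd_mul.1 hA
    obtain ⟨hb, hy⟩ := Nat.odd_mul.1 hB
    rw [mem_oddQuadruples, Nat.mul_div_cancel_left _ ha.pos, Nat.mul_div_cancel_left _ hb.pos]
    exact ⟨⟨Nat.odd_iff.1 ha, Nat.odd_iff.1 hx, Nat.odd_iff.1 hb, Nat.odd_iff.1 hy⟩, hAB⟩
  · rintro ⟨a, x, b, y⟩ h
    obtain ⟨⟨ha, hx, hb, hy⟩, h⟩ := mem_oddQuadruples.1 h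
    simp only [mem_sigma, mem_filter, HasAntidiagonal.mem_antidiagonal, mem_product,
      Nat.mem_divisors]
    refine ⟨⟨h, Nat.odd_mul.2 ⟨Nat.odd_iff.2 ha, Nat.odd_iff.2 hx⟩⟩, ⟨Dvd.intro _ rfl, ?_⟩,
      Dvd.intro _ rfl, ?_⟩
    · exact (Nat.mul_pos (by omega) (by omega)).ne'
    · exact (Nat.mul_pos (by omega) (by omega)).ne'
  · rintro ⟨⟨A, B⟩, a, b⟩ h
    simp only [mem_sigma, mem_product, Nat.mem_divisors] at h
    simp only [Nat.mul_div_cancel' h.2.1.1, Nat.mul_div_cancel' h.2.2.1]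
  · rintro ⟨a, x, b, y⟩ h
    obtain ⟨⟨ha, hx, hb, hy⟩, h⟩ := mem_oddQuadruples.1 h
    simp only [Nat.mul_div_cancel_left x (show 0 < a by omega),
      Nat.mul_div_cancel_left y (show 0 < b by omega)]
  · intros; rfl

/-- A finite set is counted along the fibres of a map. -/
theorem ncard_eq_sum_ncard_fiber {α β : Type*} [DecidableEq β] {S : Set α} (hS : S.Finite)
    {t : Finset β} {f : α → β} (hf : ∀ v ∈ S, f v ∈ t) :
    S.ncard = ∑ b ∈ t, {v | v ∈ S ∧ f v = b}.ncard := by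
  classical
  rw [Set.ncard_eq_toFinset_card S hS, card_eq_sum_card_fiberwise (f := f) (t := t)
    (fun v hv => hf v (by simpa using hv))]
  refine sum_congr rfl fun b _ => ?_
  rw [← Set.ncard_coe_finset]
  congr 1
  ext
  simp

theorem tRep_sq (n : ℕ) :
    tRep 1 1 2 ((n : ℤ) ^ 2) = ∑ x ∈ antidiagonal (2 * n), binRep 2 (x.1 * x.2) := by
  have hy {v : ℤ × ℤ × ℤ} (hv : tVal 1 1 2 v = (n : ℤ) ^ 2) : |v.2.1| ≤ n := by
    refine abs_le_of_sq_le_sq ?_ (Int.natCast_nonneg n)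
    simp only [tVal] at hv
    nlinarith [sq_nonneg v.1, sq_nonneg v.2.2]
  have hfin : {v : ℤ × ℤ × ℤ | tVal 1 1 2 v = (n : ℤ) ^ 2}.Finite := by
    have hIcc := Set.finite_Icc (-(n : ℤ)) n
    refine (hIcc.prod (hIcc.prod hIcc)).subset fun v hv => ?_
    have hn := Int.natCast_nonneg n
    simp only [Set.mem_ofPred_eq, tVal] at hv
    refine ⟨abs_le.1 (abs_le_of_sq_le_sq ?_ hn), abs_le.1 (hy hv),
      abs_le.1 (abs_le_of_sq_le_sq ?_ hn)⟩ <;>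
      nlinarith [sq_nonneg v.1, sq_nonneg v.2.1, sq_nonneg v.2.2]
  rw [tRep, ncard_eq_sum_ncard_fiber hfin (t := antidiagonal (2 * n))
    (f := fun v => ((n - v.2.1).toNat, (n + v.2.1).toNat))]
  · refine sum_congr rfl ?_
    rintro ⟨A, B⟩ hAB
    rw [HasAntidiagonal.mem_antidiagonal] at hAB
    simp only at hAB ⊢
    have hinj : Function.Injective fun w : ℤ × ℤ => (w.1, (n : ℤ) - A, w.2) := by
      rintro ⟨x, z⟩ ⟨x', z'⟩ h
      simpa using h
    rw [binRep, ← Set.ncard_image_of_injective _ hinj]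
    congr 1
    have hB : (B : ℤ) = 2 * n - A := by omega
    ext ⟨x, y, z⟩
    simp only [Set.mem_ofPred_eq, Set.mem_image, Prod.mk.injEq, Prod.exists, tVal]
    constructor
    · rintro ⟨h, hA, hB'⟩
      have := abs_le.1 (hy (v := (x, y, z)) h)
      obtain rfl : y = n - A := by simp only at this; omega
      refine ⟨x, z, ?_, rfl, rfl, rfl⟩
      push_cast
      rw [hB]
      linear_combination h
    · rintro ⟨x, z, h, rfl, rfl, rfl⟩
      push_cast at h
      rw [hB] at h
      exact ⟨by linear_combination h, by omega, by omega⟩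
  · intro v hv
    have := abs_le.1 (hy hv)
    rw [HasAntidiagonal.mem_antidiagonal]
    simp only
    omega

/-- The representations of `N` by `x² + D y² + z² + D w²`. -/
def quatSet (D : ℤ) (N : ℕ) : Set ((ℤ × ℤ) × (ℤ × ℤ)) :=
  {v | (v.1.1 ^ 2 + D * v.1.2 ^ 2) + (v.2.1 ^ 2 + D * v.2.2 ^ 2) = N}

theorem finite_quatSet {D : ℤ} (hD : 0 < D) (N : ℕ) : (quatSet D N).Finite := by
  have hfin : {w : ℤ × ℤ | w.1 ^ 2 + D * w.2 ^ 2 ≤ N}.Finite := by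
    refine ((Set.finite_Icc (0 : ℤ) N).biUnion fun M _ => finite_binary hD M).subset ?_
    intro w hw
    simp only [Set.mem_iUnion, Set.mem_ofPred_eq, exists_prop]
    exact ⟨_, ⟨by positivity, hw⟩, rfl⟩
  refine (hfin.prod hfin).subset fun v hv => ?_
  simp only [quatSet, Set.mem_ofPred_eq] at hv
  have h₁ : 0 ≤ v.1.1 ^ 2 + D * v.1.2 ^ 2 := by positivity
  have h₂ : 0 ≤ v.2.1 ^ 2 + D * v.2.2 ^ 2 := by positivity
  constructor <;> simp only [Set.mem_ofPred_eq] <;> omega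

theorem ncard_quatSet_inter {D : ℤ} (hD : 0 < D) (N : ℕ) (P : ℕ → Prop) [DecidablePred P] :
    {v | v ∈ quatSet D N ∧ P (v.1.1 ^ 2 + D * v.1.2 ^ 2).toNat}.ncard =
      ∑ x ∈ antidiagonal N with P x.1, binRep D x.1 * binRep D x.2 := by
  have h₁ (w : ℤ × ℤ) : 0 ≤ w.1 ^ 2 + D * w.2 ^ 2 := by positivity
  rw [ncard_eq_sum_ncard_fiber ((finite_quatSet hD N).subset fun v hv => hv.1)
    (t := {x ∈ antidiagonal N | P x.1})
    (f := fun v => ((v.1.1 ^ 2 + D * v.1.2 ^ 2).toNat, (v.2.1 ^ 2 + D * v.2.2 ^ 2).toNat))]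
  · refine sum_congr rfl ?_
    rintro ⟨A, B⟩ hAB
    rw [mem_filter, HasAntidiagonal.mem_antidiagonal] at hAB
    simp only at hAB
    rw [binRep, binRep, ← Set.ncard_prod]
    congr 1
    ext v
    have := h₁ v.1
    have := h₁ v.2
    simp only [Set.mem_ofPred_eq, Set.mem_prod, quatSet, Prod.mk.injEq]
    constructor
    · rintro ⟨⟨h, -⟩, hA, hB⟩
      omega
    · rintro ⟨hA, hB⟩
      rw [hA, hB]
      refine ⟨⟨by omega, ?_⟩, by simp⟩
      simpa using hAB.2
  · rintro v ⟨hv, hP⟩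
    have := h₁ v.1
    have := h₁ v.2
    simp only [Set.mem_ofPred_eq, quatSet] at hv
    rw [mem_filter, HasAntidiagonal.mem_antidiagonal]
    exact ⟨by simp only; omega, hP⟩

theorem ncard_quatSet {D : ℤ} (hD : 0 < D) (N : ℕ) :
    (quatSet D N).ncard = ∑ x ∈ antidiagonal N, binRep D x.1 * binRep D x.2 := by
  simpa using ncard_quatSet_inter hD N (fun _ => True)

theorem sq_emod_four (x : ℤ) : x ^ 2 % 4 = x % 2 := by
  obtain ⟨k, rfl | rfl⟩ := Int.even_or_odd' x
  · rw [mul_pow]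
    omega
  · ring_nf
    omega

theorem ncard_quatSet_two (N : ℕ) : (quatSet 2 (2 * N)).ncard = (quatSet 1 N).ncard := by
  have hinj : Function.Injective fun v : (ℤ × ℤ) × (ℤ × ℤ) =>
      ((v.1.1 + v.1.2, v.2.1), (v.1.1 - v.1.2, v.2.2)) := by
    rintro ⟨⟨x, y⟩, z, w⟩ ⟨⟨x', y'⟩, z', w'⟩ h
    simp only [Prod.mk.injEq] at h ⊢
    omega
  rw [← Set.ncard_image_of_injective (quatSet 1 N) hinj]
  congr 1
  ext ⟨⟨x, y⟩, z, w⟩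
  simp only [quatSet, Set.mem_ofPred_eq, Set.mem_image, Prod.mk.injEq, Prod.exists]
  push_cast
  constructor
  · intro h
    have hx := sq_emod_four x
    have hz := sq_emod_four z
    obtain ⟨k, rfl⟩ : ∃ k, x = z + 2 * k := ⟨(x - z) / 2, by omega⟩
    exact ⟨z + k, k, by linarith, ⟨by ring, rfl⟩, by ring, rfl⟩
  · rintro ⟨a, b, h, ⟨rfl, -⟩, rfl, -⟩
    linarith

theorem ncard_quatSet_even (N : ℕ) :
    {v | v ∈ quatSet 1 (2 * N) ∧ Even (v.1.1 + v.1.2)}.ncard = (quatSet 1 N).ncard := by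
  have hinj : Function.Injective fun v : (ℤ × ℤ) × (ℤ × ℤ) =>
      ((v.1.1 + v.1.2, v.1.1 - v.1.2), (v.2.1 + v.2.2, v.2.1 - v.2.2)) := by
    rintro ⟨⟨x, y⟩, z, w⟩ ⟨⟨x', y'⟩, z', w'⟩ h
    simp only [Prod.mk.injEq] at h ⊢
    omega
  rw [← Set.ncard_image_of_injective (quatSet 1 N) hinj]
  congr 1
  ext ⟨⟨x, y⟩, z, w⟩
  simp only [quatSet, Set.mem_ofPred_eq, Set.mem_image, Prod.mk.injEq, Prod.exists]
  push_cast
  constructor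
  · rintro ⟨h, hxy⟩
    have hx := sq_emod_four x
    have hy := sq_emod_four y
    have hz := sq_emod_four z
    have hw := sq_emod_four w
    rw [Int.even_iff] at hxy
    obtain ⟨k, rfl⟩ : ∃ k, x = y + 2 * k := ⟨(x - y) / 2, by omega⟩
    obtain ⟨l, rfl⟩ : ∃ l, z = w + 2 * l := ⟨(z - w) / 2, by omega⟩
    exact ⟨y + k, k, w + l, l, by linarith, ⟨by ring, by ring⟩, by ring, by ring⟩
  · rintro ⟨a, b, c, d, h, ⟨rfl, rfl⟩, rfl, rfl⟩
    exact ⟨by linarith, a, by ring⟩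

theorem ncard_quatSet_two_mul_of_even {N : ℕ} (hN : Even N) :
    (quatSet 1 (2 * N)).ncard = (quatSet 1 N).ncard := by
  rw [← ncard_quatSet_even N]
  congr 1
  ext ⟨⟨x, y⟩, z, w⟩
  simp only [quatSet, Set.mem_ofPred_eq, iff_self_and]
  intro h
  have hx := sq_emod_four x
  have hy := sq_emod_four y
  have hz := sq_emod_four z
  have hw := sq_emod_four w
  rw [Nat.even_iff] at hN
  rw [Int.even_iff]
  push_cast at h
  omega

theorem ncard_quatSet_odd {N : ℕ} (hN : Odd N) :
    {v | v ∈ quatSet 1 (2 * N) ∧ ¬ Even (v.1.1 + v.1.2)}.ncard = 2 * (quatSet 1 N).ncard := by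
  have hfin := finite_quatSet one_pos (2 * N)
  have hunion : {v | v ∈ quatSet 1 (2 * N) ∧ ¬ Even (v.1.1 + v.1.2)} =
      {v | v ∈ quatSet 1 (2 * N) ∧ Even (v.1.1 + v.2.1)} ∪
        {v | v ∈ quatSet 1 (2 * N) ∧ Even (v.1.1 + v.2.2)} := by
    ext ⟨⟨x, y⟩, z, w⟩
    simp only [Set.mem_union, Set.mem_ofPred_eq, ← and_or_left, and_congr_right_iff, quatSet]
    intro h
    have hx := sq_emod_four x
    have hy := sq_emod_four y
    have hz := sq_emod_four z
    have hw := sq_emod_four w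
    rw [Nat.odd_iff] at hN
    simp only [Int.even_iff]
    push_cast at h
    omega
  have hdisj : Disjoint {v | v ∈ quatSet 1 (2 * N) ∧ Even (v.1.1 + v.2.1)}
      {v | v ∈ quatSet 1 (2 * N) ∧ Even (v.1.1 + v.2.2)} := by
    rw [Set.disjoint_left]
    rintro ⟨⟨x, y⟩, z, w⟩ ⟨h, h₁⟩ ⟨-, h₂⟩
    have hx := sq_emod_four x
    have hy := sq_emod_four y
    have hz := sq_emod_four z
    have hw := sq_emod_four w
    rw [Nat.odd_iff] at hN
    simp only [Int.even_iff, quatSet, Set.mem_ofPred_eq] at h h₁ h₂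
    push_cast at h
    omega
  rw [hunion, Set.ncard_union_eq hdisj (hfin.subset fun v h => h.1) (hfin.subset fun v h => h.1),
    two_mul (quatSet 1 N).ncard, ← ncard_quatSet_even N]
  congr 1
  · rw [← Set.ncard_image_of_injective {v | v ∈ quatSet 1 (2 * N) ∧ Even (v.1.1 + v.2.1)}
      (f := fun v => ((v.1.1, v.2.1), (v.1.2, v.2.2)))]
    · congr 1
      ext ⟨⟨x, y⟩, z, w⟩
      simp only [quatSet, Set.mem_ofPred_eq, Set.mem_image, Prod.mk.injEq, Prod.exists]
      constructor
      · rintro ⟨a, b, c, d, ⟨h, h'⟩, ⟨rfl, rfl⟩, rfl, rfl⟩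
        exact ⟨by linarith, h'⟩
      · rintro ⟨h, h'⟩
        exact ⟨x, z, y, w, ⟨by linarith, h'⟩, by simp⟩
    · rintro ⟨⟨x, y⟩, z, w⟩ ⟨⟨x', y'⟩, z', w'⟩ h
      simp only [Prod.mk.injEq] at h ⊢
      omega
  · rw [← Set.ncard_image_of_injective {v | v ∈ quatSet 1 (2 * N) ∧ Even (v.1.1 + v.2.2)}
      (f := fun v => ((v.1.1, v.2.2), (v.2.1, v.1.2)))]
    · congr 1
      ext ⟨⟨x, y⟩, z, w⟩
      simp only [quatSet, Set.mem_ofPred_eq, Set.mem_image, Prod.mk.injEq, Prod.exists]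
      constructor
      · rintro ⟨a, b, c, d, ⟨h, h'⟩, ⟨rfl, rfl⟩, rfl, rfl⟩
        exact ⟨by linarith, h'⟩
      · rintro ⟨h, h'⟩
        exact ⟨x, w, z, y, ⟨by linarith, h'⟩, by simp⟩
    · rintro ⟨⟨x, y⟩, z, w⟩ ⟨⟨x', y'⟩, z', w'⟩ h
      simp only [Prod.mk.injEq] at h ⊢
      omega

theorem ncard_quatSet_two_mul_of_odd {N : ℕ} (hN : Odd N) :
    (quatSet 1 (2 * N)).ncard = 3 * (quatSet 1 N).ncard := by
  have h := Set.ncard_inter_add_ncard_sdiff_eq_ncard (quatSet 1 (2 * N))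
    {v | Even (v.1.1 + v.1.2)} (finite_quatSet one_pos _)
  rw [← Set.sep_mem_eq] at h
  have h₁ := ncard_quatSet_even N
  have h₂ := ncard_quatSet_odd hN
  change _ + Set.ncard {v | v ∈ quatSet 1 (2 * N) ∧ ¬ Even (v.1.1 + v.1.2)} = _ at h
  simp only [Set.mem_ofPred_eq] at h
  omega

/-- Jacobi's four-square theorem for odd numbers. -/
theorem ncard_quatSet_one_of_odd {n : ℕ} (hn : Odd n) :
    ((quatSet 1 n).ncard : ℤ) = 8 * ArithmeticFunction.sigma 1 n := by
  have h := ncard_quatSet_inter one_pos (2 * n) Odd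
  have hset : {v | v ∈ quatSet 1 (2 * n) ∧ Odd (v.1.1 ^ 2 + 1 * v.1.2 ^ 2).toNat} =
      {v | v ∈ quatSet 1 (2 * n) ∧ ¬ Even (v.1.1 + v.1.2)} := by
    ext ⟨⟨x, y⟩, z, w⟩
    have hx := sq_emod_four x
    have hy := sq_emod_four y
    have : 0 ≤ x ^ 2 + 1 * y ^ 2 := by positivity
    simp only [Set.mem_ofPred_eq, and_congr_right_iff, Int.even_iff, Nat.odd_iff]
    omega
  rw [hset, ncard_quatSet_odd hn] at h
  have hsum : ((∑ x ∈ antidiagonal (2 * n) with Odd x.1, binRep 1 x.1 * binRep 1 x.2 : ℕ) : ℤ) =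
      16 * ArithmeticFunction.sigma 1 n := by
    rw [← sum_antidiagonal_charDivisorSum hn, mul_sum]
    push_cast
    refine sum_congr rfl ?_
    rintro ⟨A, B⟩ hAB
    simp only [mem_filter, HasAntidiagonal.mem_antidiagonal, Nat.odd_iff] at hAB
    rw [binRep_one_eq (by simp only; omega), binRep_one_eq (by simp only; omega)]
    ring
  rw [← h] at hsum
  push_cast at hsum
  linarith

theorem exists_ncard_quatSet_one (t : ℕ) :
    ∃ C : ℤ, ∀ n : ℕ, Odd n →
      ((quatSet 1 (2 ^ t * n)).ncard : ℤ) = C * ArithmeticFunction.sigma 1 n := by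
  induction t with
  | zero => exact ⟨8, fun n hn => by rw [pow_zero, one_mul, ncard_quatSet_one_of_odd hn]⟩
  | succ t ih =>
    obtain ⟨C, hC⟩ := ih
    rcases t with _ | t
    · refine ⟨3 * C, fun n hn => ?_⟩
      rw [pow_succ', mul_assoc, pow_zero, one_mul, ncard_quatSet_two_mul_of_odd hn, mul_assoc,
        ← hC n hn]
      simp
    · refine ⟨C, fun n hn => ?_⟩
      rw [pow_succ', mul_assoc, ncard_quatSet_two_mul_of_even, hC n hn]
      rw [pow_succ', mul_assoc]
      exact even_two_mul _

theorem sum_antidiagonal_binRep_two_mul {M : ℕ} (hM : 0 < M) :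
    ((∑ x ∈ antidiagonal M, binRep 2 x.1 * binRep 2 x.2 : ℕ) : ℤ) =
      2 * ∑ g ∈ M.divisors,
        chiEight g * ((∑ x ∈ antidiagonal (M / g), binRep 2 (x.1 * x.2) : ℕ) : ℤ) := by
  have hpos {x : ℕ × ℕ} (hx : x ∈ antidiagonal M) : 0 < x.1 + x.2 := by
    rwa [HasAntidiagonal.mem_antidiagonal.1 hx]
  push_cast
  rw [sum_congr rfl fun x hx => binRep_two_mul (hpos hx), ← mul_sum]
  congr 1
  simp only [mul_sum]
  rw [sum_sigma', sum_sigma']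
  refine sum_bij' (i := fun z _ => ⟨z.2, (z.1.1 / z.2, z.1.2 / z.2)⟩)
    (j := fun z _ => ⟨(z.1 * z.2.1, z.1 * z.2.2), z.1⟩) ?_ ?_ ?_ ?_ ?_
  · rintro ⟨⟨A, B⟩, g⟩ h
    simp only [mem_sigma, HasAntidiagonal.mem_antidiagonal, Nat.mem_divisors,
      Nat.dvd_gcd_iff] at h ⊢
    obtain ⟨hAB, ⟨hA, hB⟩, -⟩ := h
    rw [← Nat.add_div_of_dvd_right hA, hAB]
    exact ⟨⟨hAB ▸ dvd_add hA hB, hM.ne'⟩, rfl⟩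
  · rintro ⟨g, a, b⟩ h
    simp only [mem_sigma, HasAntidiagonal.mem_antidiagonal, Nat.mem_divisors,
      Nat.dvd_gcd_iff] at h ⊢
    obtain ⟨⟨hg, -⟩, hab⟩ := h
    have hgM : g * a + g * b = M := by rw [← mul_add, hab, Nat.mul_div_cancel' hg]
    refine ⟨hgM, ⟨dvd_mul_right _ _, dvd_mul_right _ _⟩, fun h0 => ?_⟩
    rw [Nat.gcd_eq_zero_iff] at h0
    omega
  · rintro ⟨⟨A, B⟩, g⟩ h
    simp only [mem_sigma, Nat.mem_divisors, Nat.dvd_gcd_iff] at h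
    simp only [Nat.mul_div_cancel' h.2.1.1, Nat.mul_div_cancel' h.2.1.2]
  · rintro ⟨g, a, b⟩ h
    simp only [mem_sigma, Nat.mem_divisors] at h
    have hg := Nat.pos_of_dvd_of_pos h.1.1 hM
    simp only [Nat.mul_div_cancel_left _ hg]
  · intros; rfl

theorem chiEight_eq_zero {g : ℕ} (hg : ¬ Odd g) : chiEight g = 0 := by
  rw [chiEight_apply, ZMod.χ₈'_nat_eq_if_mod_eight, if_pos (by rw [Nat.odd_iff] at hg; omega)]

/-- The convolution of the squares represented by `x² + y² + 2 z²` with the character of conductor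
`8` attached to `-2` counts representations by four squares. -/
theorem sum_chiEight_mul_tRep (t : ℕ) {n : ℕ} (hn : Odd n) :
    2 * ∑ g ∈ n.divisors, chiEight g * (tRep 1 1 2 (((2 ^ t * (n / g) : ℕ) : ℤ) ^ 2) : ℤ) =
      (quatSet 1 (2 ^ t * n)).ncard := by
  have hpos : 0 < 2 ^ t * n := Nat.mul_pos (by positivity) hn.pos
  rw [← ncard_quatSet_two, ncard_quatSet two_pos]
  rw [sum_antidiagonal_binRep_two_mul (by omega)]
  congr 1
  have hsub : n.divisors ⊆ (2 * (2 ^ t * n)).divisors :=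
    Nat.divisors_subset_of_dvd (by omega) ((dvd_mul_left n _).mul_left 2)
  rw [← sum_subset hsub]
  · refine sum_congr rfl fun g hg => ?_
    obtain ⟨k, rfl⟩ := Nat.dvd_of_mem_divisors hg
    have hg := Nat.pos_of_mem_divisors hg
    rw [show 2 * (2 ^ t * (g * k)) = g * (2 * (2 ^ t * k)) by ring, Nat.mul_div_cancel_left _ hg,
      Nat.mul_div_cancel_left _ hg, tRep_sq]
  · intro g hg hgn
    rw [chiEight_eq_zero, zero_mul]
    intro hodd
    refine hgn (Nat.mem_divisors.2 ⟨?_, hn.pos.ne'⟩)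
    have h := Nat.dvd_of_mem_divisors hg
    rw [← mul_assoc, ← pow_succ'] at h
    exact (Nat.Coprime.pow_right _ hodd.coprime_two_right).dvd_of_dvd_mul_left h

/-- A completely multiplicative function as an arithmetic function. -/
def charArith (χ : ℕ →* ℤ) (h0 : χ 0 = 0) : ArithmeticFunction ℤ := ⟨χ, h0⟩

theorem charArith_apply (χ : ℕ →* ℤ) (h0 : χ 0 = 0) (n : ℕ) : charArith χ h0 n = χ n := rfl

/-- The Dirichlet convolution of `μ χ` and `σ`. -/
def twistedSigma (χ : ℕ →* ℤ) (h0 : χ 0 = 0) : ArithmeticFunction ℤ :=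
  ArithmeticFunction.moebius.pmul (charArith χ h0) *
    (ArithmeticFunction.sigma 1 : ArithmeticFunction ℕ)

theorem moebius_pmul_charArith_mul (χ : ℕ →* ℤ) (h0 : χ 0 = 0) :
    ArithmeticFunction.moebius.pmul (charArith χ h0) * charArith χ h0 = 1 := by
  ext n
  have h : ∀ x ∈ n.divisorsAntidiagonal,
      ArithmeticFunction.moebius.pmul (charArith χ h0) x.1 * charArith χ h0 x.2 =
        χ n * (ArithmeticFunction.moebius x.1 *
          (ArithmeticFunction.zeta : ArithmeticFunction ℤ) x.2) := by
    intro x hx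
    rw [Nat.mem_divisorsAntidiagonal] at hx
    have hx2 : x.2 ≠ 0 := by rintro h; simp [h] at hx; omega
    rw [ArithmeticFunction.pmul_apply, charArith_apply, charArith_apply, ← hx.1, map_mul,
      ArithmeticFunction.natCoe_apply, ArithmeticFunction.zeta_apply_ne hx2]
    push_cast
    ring
  rw [ArithmeticFunction.mul_apply, sum_congr rfl h, ← mul_sum, ← ArithmeticFunction.mul_apply,
    ArithmeticFunction.moebius_mul_coe_zeta, ArithmeticFunction.one_apply]
  split_ifs with h1
  · rw [h1, map_one, one_mul]
  · rw [mul_zero]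

theorem isMultiplicative_twistedSigma (χ : ℕ →* ℤ) (h0 : χ 0 = 0) :
    (twistedSigma χ h0).IsMultiplicative := by
  refine ((ArithmeticFunction.isMultiplicative_moebius).pmul ⟨map_one χ, ?_⟩).mul
    (ArithmeticFunction.isMultiplicative_sigma (k := 1)).natCast
  intro m n _
  exact map_mul χ m n

theorem twistedSigma_prime_pow (χ : ℕ →* ℤ) (h0 : χ 0 = 0) {p : ℕ} (hp : p.Prime) (k : ℕ) :
    twistedSigma χ h0 (p ^ (k + 1)) =
      ∑ i ∈ range (k + 2), (p : ℤ) ^ i - χ p * ∑ i ∈ range (k + 1), (p : ℤ) ^ i := by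
  rw [twistedSigma, ArithmeticFunction.mul_apply, Nat.sum_divisorsAntidiagonal (fun a b =>
    (ArithmeticFunction.moebius.pmul (charArith χ h0)) a *
      ((ArithmeticFunction.sigma 1 : ArithmeticFunction ℕ) : ArithmeticFunction ℤ) b),
    Nat.sum_divisors_prime_pow hp, sum_range_succ', sum_range_succ', sum_eq_zero]
  · simp only [ArithmeticFunction.pmul_apply, charArith_apply, ArithmeticFunction.natCoe_apply,
      zero_add, pow_one, pow_zero, Nat.div_one, ArithmeticFunction.moebius_apply_prime hp]
    rw [pow_succ p k, Nat.mul_div_cancel _ hp.pos, ← pow_succ,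
      ArithmeticFunction.sigma_one_apply_prime_pow hp,
      ArithmeticFunction.sigma_one_apply_prime_pow hp]
    simp
    ring
  · intro i _
    rw [ArithmeticFunction.pmul_apply, ArithmeticFunction.moebius_apply_prime_pow hp (by omega),
      if_neg (by omega), zero_mul, zero_mul]

theorem tHp_eq {p : ℕ} (hp : p.Prime) (hodd : Odd p) (k : ℕ) :
    tHp 1 1 2 p k =
      ∑ i ∈ range (k + 1), (p : ℤ) ^ i - chiEight p * ∑ i ∈ range k, (p : ℤ) ^ i := by
  have hp1 : (p : ℤ) - 1 ≠ 0 := by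
    have := hp.one_lt
    omega
  have h (j : ℕ) : ((p : ℤ) ^ j - 1) / ((p : ℤ) - 1) = ∑ i ∈ range j, (p : ℤ) ^ i := by
    rw [← geom_sum_mul, Int.mul_ediv_cancel _ hp1]
  rw [tHp, h, h, chiEight_apply, ← jacobiSym.at_neg_two hodd]
  norm_num

theorem chiEight_zero : chiEight 0 = 0 := chiEight_eq_zero (by decide)

theorem twistedSigma_chiEight {n : ℕ} (hn : Odd n) :
    twistedSigma chiEight chiEight_zero n =
      ∏ p ∈ n.primeFactors, tHp 1 1 2 p (n.factorization p) := by
  rw [(isMultiplicative_twistedSigma _ _).multiplicative_factorization _ hn.pos.ne', Finsupp.prod,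
    Nat.support_factorization]
  refine prod_congr rfl fun p hp => ?_
  have hpp := Nat.prime_of_mem_primeFactors hp
  have hdvd := Nat.dvd_of_mem_primeFactors hp
  obtain ⟨k, hk⟩ := Nat.exists_eq_succ_of_ne_zero
    (hpp.factorization_pos_of_dvd hn.pos.ne' hdvd).ne'
  rw [hk, twistedSigma_prime_pow _ _ hpp, tHp_eq hpp (Odd.of_dvd_nat hn hdvd)]

/-- The ternary form `x² + 1y² + 2z²`-type form `⟨1,1,2⟩` is strongly s-regular. -/
theorem stmt_15 (n₁ n₂ : ℕ) (h₁ : 0 < n₁) (h₂ : 0 < n₂)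
    (hpow : ∃ t : ℕ, n₁ = 2 ^ t) (hodd : Odd n₂) :
    (tRep 1 1 2 (((n₁ : ℤ) * (n₂ : ℤ)) ^ 2) : ℤ) =
      (tRep 1 1 2 ((n₁ : ℤ) ^ 2) : ℤ) *
        ∏ p ∈ n₂.primeFactors, tHp 1 1 2 p (n₂.factorization p) := by
  obtain ⟨t, rfl⟩ := hpow
  obtain ⟨C, hC⟩ := exists_ncard_quatSet_one t
  let G : ArithmeticFunction ℤ :=
    ⟨fun n => if n = 0 then 0 else (tRep 1 1 2 (((2 ^ t * n : ℕ) : ℤ) ^ 2) : ℤ), by simp⟩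
  have hG {n : ℕ} (hn : n ≠ 0) : G n = (tRep 1 1 2 (((2 ^ t * n : ℕ) : ℤ) ^ 2) : ℤ) := by
    simp [G, hn]
  have hconv {n : ℕ} (hn : Odd n) :
      2 * (charArith chiEight chiEight_zero * G) n = C * ArithmeticFunction.sigma 1 n := by
    rw [← hC n hn, ← sum_chiEight_mul_tRep t hn, ArithmeticFunction.mul_apply,
      Nat.sum_divisorsAntidiagonal (fun a b => charArith chiEight chiEight_zero a * G b)]
    congr 1
    refine sum_congr rfl fun g hg => ?_
    rw [charArith_apply, hG]
    exact (Nat.div_pos (Nat.divisor_le hg) (Nat.pos_of_mem_divisors hg)).ne'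
  have hformula {n : ℕ} (hn : Odd n) :
      2 * G n = C * twistedSigma chiEight chiEight_zero n := by
    rw [← one_mul G, ← moebius_pmul_charArith_mul chiEight chiEight_zero, mul_assoc, twistedSigma,
      ArithmeticFunction.mul_apply, ArithmeticFunction.mul_apply, mul_sum, mul_sum]
    refine sum_congr rfl fun x hx => ?_
    rw [mul_left_comm, hconv, mul_left_comm, ArithmeticFunction.natCoe_apply]
    exact Odd.of_dvd_nat hn (Dvd.intro_left _ (Nat.mem_divisorsAntidiagonal.1 hx).1)
  have hone := hformula odd_one
  have hn := hformula hodd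
  rw [(isMultiplicative_twistedSigma _ _).map_one, mul_one, hG one_ne_zero, mul_one] at hone
  rw [hG h₂.ne', twistedSigma_chiEight hodd, ← hone, mul_assoc] at hn
  have := mul_left_cancel₀ two_ne_zero hn
  rwa [Nat.cast_mul] at this
end

section
/- The ternary quadratic form x² + y² + 3z² is strongly s-regular: for every positive integer n = n₁n₂ with every prime factor of n₁ in {2, 3} and gcd(n₂, 6) = 1, r(n₁²n₂², f) = r(n₁², f) · ∏_{p | n₂} h_p(ord_p(n₂)). -/
open Finset

/-- The quadruples `(a, x, b, y)` of positive integers with `a x + b y = n`. -/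
def quads (n : ℕ) : Finset (ℕ × ℕ × ℕ × ℕ) :=
  (Icc 1 n ×ˢ Icc 1 n ×ˢ Icc 1 n ×ˢ Icc 1 n).filter
    fun q => q.1 * q.2.1 + q.2.2.1 * q.2.2.2 = n

theorem mem_quads {n a x b y : ℕ} :
    (a, x, b, y) ∈ quads n ↔ 0 < a ∧ 0 < x ∧ 0 < b ∧ 0 < y ∧ a * x + b * y = n := by
  simp only [quads, mem_filter, mem_product, mem_Icc]
  constructor
  · rintro ⟨⟨⟨h1, -⟩, ⟨h2, -⟩, ⟨h3, -⟩, h4, -⟩, h⟩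
    exact ⟨h1, h2, h3, h4, h⟩
  · rintro ⟨h1, h2, h3, h4, h⟩
    have := Nat.mul_pos h1 h2
    have := Nat.mul_pos h3 h4
    have := Nat.le_mul_of_pos_right a h2
    have := Nat.le_mul_of_pos_left x h1
    have := Nat.le_mul_of_pos_right b h4
    have := Nat.le_mul_of_pos_left y h3
    refine ⟨⟨⟨h1, ?_⟩, ⟨h2, ?_⟩, ⟨h3, ?_⟩, h4, ?_⟩, h⟩ <;> omega

theorem sum_filter_trichotomy {ι M : Type*} [AddCommMonoid M] (s : Finset ι) (u v : ι → ℕ)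
    (f : ι → M) :
    ∑ i ∈ s, f i = ∑ i ∈ s with u i = v i, f i + ∑ i ∈ s with u i < v i, f i +
      ∑ i ∈ s with v i < u i, f i := by
  simp only [sum_filter, ← sum_add_distrib]
  refine sum_congr rfl fun i _ => ?_
  rcases lt_trichotomy (u i) (v i) with h | h | h
  · simp [h, h.ne, h.not_gt]
  · simp [h]
  · simp [h, h.ne', h.not_gt]

theorem sum_quads_swap {M : Type*} [AddCommMonoid M] (n : ℕ) (f : ℕ × ℕ × ℕ × ℕ → M) :
    ∑ q ∈ quads n, f (q.2.2.1, q.2.2.2, q.1, q.2.1) = ∑ q ∈ quads n, f q := by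
  refine sum_nbij' (fun q => (q.2.2.1, q.2.2.2, q.1, q.2.1))
    (fun q => (q.2.2.1, q.2.2.2, q.1, q.2.1)) ?_ ?_ ?_ ?_ ?_ <;>
  · rintro ⟨a, x, b, y⟩
    simp only [mem_quads]
    grind

theorem sum_quads_lt_fst (n : ℕ) (F : ℤ → ℤ) :
    ∑ q ∈ quads n with q.2.2.1 < q.1, F (q.1 - q.2.2.1) =
      ∑ q ∈ quads n with q.2.1 < q.2.2.2, F q.1 := by
  refine sum_nbij' (fun q => (q.1 - q.2.2.1, q.2.1, q.2.2.1, q.2.1 + q.2.2.2))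
    (fun q => (q.1 + q.2.2.1, q.2.1, q.2.2.1, q.2.2.2 - q.2.1)) ?_ ?_ ?_ ?_ ?_
  · rintro ⟨a, x, b, y⟩
    simp only [mem_filter, mem_quads]
    rintro ⟨⟨h1, h2, h3, h4, h⟩, h'⟩
    obtain ⟨c, rfl⟩ := Nat.exists_eq_add_of_lt h'
    have : b + c + 1 - b = c + 1 := by omega
    rw [this]
    refine ⟨⟨by omega, h2, h3, by omega, ?_⟩, by omega⟩
    rw [← h]; ring
  · rintro ⟨a, x, b, y⟩
    simp only [mem_filter, mem_quads]
    rintro ⟨⟨h1, h2, h3, h4, h⟩, h'⟩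
    obtain ⟨c, rfl⟩ := Nat.exists_eq_add_of_lt h'
    have : x + c + 1 - x = c + 1 := by omega
    rw [this]
    refine ⟨⟨by omega, h2, h3, by omega, ?_⟩, by omega⟩
    rw [← h]; ring
  · rintro ⟨a, x, b, y⟩
    simp only [mem_filter, mem_quads]
    rintro ⟨-, h'⟩
    simp only [Prod.mk.injEq, true_and]
    omega
  · rintro ⟨a, x, b, y⟩
    simp only [mem_filter, mem_quads]
    rintro ⟨-, h'⟩
    simp only [Prod.mk.injEq, true_and]
    omega
  · rintro ⟨a, x, b, y⟩
    simp only [mem_filter, mem_quads]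
    rintro ⟨-, h'⟩
    rw [Nat.cast_sub h'.le]

theorem sum_quads_lt_snd (n : ℕ) (F : ℤ → ℤ) :
    ∑ q ∈ quads n with q.2.2.2 < q.2.1, F (q.1 + q.2.2.1) =
      ∑ q ∈ quads n with q.2.2.1 < q.1, F q.1 := by
  refine sum_nbij' (fun q => (q.1 + q.2.2.1, q.2.2.2, q.1, q.2.1 - q.2.2.2))
    (fun q => (q.2.2.1, q.2.1 + q.2.2.2, q.1 - q.2.2.1, q.2.1)) ?_ ?_ ?_ ?_ ?_
  · rintro ⟨a, x, b, y⟩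
    simp only [mem_filter, mem_quads]
    rintro ⟨⟨h1, h2, h3, h4, h⟩, h'⟩
    obtain ⟨c, rfl⟩ := Nat.exists_eq_add_of_lt h'
    have : y + c + 1 - y = c + 1 := by omega
    rw [this]
    refine ⟨⟨by omega, h4, h1, by omega, ?_⟩, by omega⟩
    rw [← h]; ring
  · rintro ⟨a, x, b, y⟩
    simp only [mem_filter, mem_quads]
    rintro ⟨⟨h1, h2, h3, h4, h⟩, h'⟩
    obtain ⟨c, rfl⟩ := Nat.exists_eq_add_of_lt h'
    have : b + c + 1 - b = c + 1 := by omega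
    rw [this]
    refine ⟨⟨by omega, by omega, by omega, by omega, ?_⟩, by omega⟩
    rw [← h]; ring
  · rintro ⟨a, x, b, y⟩
    simp only [mem_filter, mem_quads]
    rintro ⟨-, h'⟩
    simp only [Prod.mk.injEq, and_true, true_and]
    omega
  · rintro ⟨a, x, b, y⟩
    simp only [mem_filter, mem_quads]
    rintro ⟨-, h'⟩
    simp only [Prod.mk.injEq, true_and]
    omega
  · rintro ⟨a, x, b, y⟩
    simp

theorem sum_quads_snd_lt (n : ℕ) (F : ℤ → ℤ) :
    ∑ q ∈ quads n with q.2.2.2 < q.2.1, F q.1 =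
      ∑ q ∈ quads n with q.1 < q.2.2.1, F q.1 := by
  refine sum_nbij' (fun q => (q.1, q.2.1 - q.2.2.2, q.1 + q.2.2.1, q.2.2.2))
    (fun q => (q.1, q.2.1 + q.2.2.2, q.2.2.1 - q.1, q.2.2.2)) ?_ ?_ ?_ ?_ ?_
  · rintro ⟨a, x, b, y⟩
    simp only [mem_filter, mem_quads]
    rintro ⟨⟨h1, h2, h3, h4, h⟩, h'⟩
    obtain ⟨c, rfl⟩ := Nat.exists_eq_add_of_lt h'
    have : y + c + 1 - y = c + 1 := by omega
    rw [this]
    refine ⟨⟨h1, by omega, by omega, h4, ?_⟩, by omega⟩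
    rw [← h]; ring
  · rintro ⟨a, x, b, y⟩
    simp only [mem_filter, mem_quads]
    rintro ⟨⟨h1, h2, h3, h4, h⟩, h'⟩
    obtain ⟨c, rfl⟩ := Nat.exists_eq_add_of_lt h'
    have : a + c + 1 - a = c + 1 := by omega
    rw [this]
    refine ⟨⟨h1, by omega, by omega, h4, ?_⟩, by omega⟩
    rw [← h]; ring
  · rintro ⟨a, x, b, y⟩
    simp only [mem_filter, mem_quads]
    rintro ⟨-, h'⟩
    simp only [Prod.mk.injEq, and_true, true_and]
    omega
  · rintro ⟨a, x, b, y⟩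
    simp only [mem_filter, mem_quads]
    rintro ⟨-, h'⟩
    simp only [Prod.mk.injEq, and_true, true_and]
    omega
  · rintro ⟨a, x, b, y⟩
    simp

theorem sum_quads_snd_eq (n : ℕ) (G : ℕ → ℕ → ℤ) :
    ∑ q ∈ quads n with q.2.1 = q.2.2.2, G q.1 q.2.2.1 =
      ∑ d ∈ n.divisors, ∑ c ∈ Ico 1 d, G c (d - c) := by
  rw [sum_sigma']
  refine sum_nbij' (fun q => ⟨q.1 + q.2.2.1, q.1⟩)
    (fun s => (s.2, n / s.1, s.1 - s.2, n / s.1)) ?_ ?_ ?_ ?_ ?_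
  · rintro ⟨a, x, b, y⟩
    simp only [mem_filter, mem_quads, mem_sigma, Nat.mem_divisors, mem_Ico]
    rintro ⟨⟨h1, h2, h3, h4, h⟩, rfl⟩
    have := Nat.mul_pos h1 h2
    refine ⟨⟨⟨x, by rw [← h]; ring⟩, ?_⟩, h1, ?_⟩ <;> omega
  · rintro ⟨d, c⟩
    simp only [mem_filter, mem_quads, mem_sigma, Nat.mem_divisors, mem_Ico]
    rintro ⟨⟨⟨k, rfl⟩, h0⟩, h1, h2⟩
    have hd : 0 < d := by omega
    rw [Nat.mul_div_cancel_left _ hd]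
    have hk : 0 < k := Nat.pos_of_ne_zero (right_ne_zero_of_mul h0)
    refine ⟨⟨h1, hk, by omega, hk, ?_⟩, trivial⟩
    rw [← add_mul]
    congr 1
    omega
  · rintro ⟨a, x, b, y⟩
    simp only [mem_filter, mem_quads]
    rintro ⟨⟨h1, h2, h3, h4, h⟩, rfl⟩
    have : n / (a + b) = x := by
      rw [← h, ← add_mul, Nat.mul_div_cancel_left _ (by omega)]
    simp [this]
  · rintro ⟨d, c⟩
    simp only [mem_sigma, mem_Ico]
    rintro ⟨-, h1, h2⟩
    simp
    omega
  · rintro ⟨a, x, b, y⟩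
    simp

theorem sum_quads_fst_eq (n : ℕ) (G : ℕ → ℤ) :
    ∑ q ∈ quads n with q.1 = q.2.2.1, G q.1 =
      ∑ d ∈ n.divisors, ((n / d : ℕ) - 1 : ℤ) * G d := by
  have : ∀ d ∈ n.divisors, ((n / d : ℕ) - 1 : ℤ) * G d = ∑ c ∈ Ico 1 (n / d), G d := by
    intro d hd
    have : 0 < n / d := Nat.div_pos (Nat.divisor_le hd) (Nat.pos_of_mem_divisors hd)
    simp [Nat.cast_sub this]
  rw [sum_congr rfl this, sum_sigma']
  refine sum_nbij' (fun q => ⟨q.1, q.2.1⟩)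
    (fun s => (s.1, s.2, s.1, n / s.1 - s.2)) ?_ ?_ ?_ ?_ ?_
  · rintro ⟨a, x, b, y⟩
    simp only [mem_filter, mem_quads, mem_sigma, Nat.mem_divisors, mem_Ico]
    rintro ⟨⟨h1, h2, h3, h4, h⟩, rfl⟩
    have := Nat.mul_pos h1 h2
    have e : n / a = x + y := by rw [← h, ← mul_add, Nat.mul_div_cancel_left _ h1]
    refine ⟨⟨⟨x + y, by rw [← h]; ring⟩, ?_⟩, h2, ?_⟩ <;> omega
  · rintro ⟨d, c⟩
    simp only [mem_filter, mem_quads, mem_sigma, Nat.mem_divisors, mem_Ico]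
    rintro ⟨⟨⟨k, rfl⟩, h0⟩, h1, h2⟩
    have hd : 0 < d := Nat.pos_of_ne_zero (left_ne_zero_of_mul h0)
    rw [Nat.mul_div_cancel_left _ hd] at h2 ⊢
    refine ⟨⟨hd, h1, hd, by omega, ?_⟩, trivial⟩
    rw [← mul_add]
    congr 1
    omega
  · rintro ⟨a, x, b, y⟩
    simp only [mem_filter, mem_quads]
    rintro ⟨⟨h1, h2, h3, h4, h⟩, rfl⟩
    have e : n / a = x + y := by rw [← h, ← mul_add, Nat.mul_div_cancel_left _ h1]
    simp [e]
  · rintro ⟨d, c⟩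
    simp
  · rintro ⟨a, x, b, y⟩
    simp

/-- Liouville's identity for even functions. -/
theorem sum_quads_sub_sub_add (n : ℕ) (F : ℤ → ℤ) (hF : ∀ x, F (-x) = F x) :
    ∑ q ∈ quads n, (F (q.1 - q.2.2.1) - F (q.1 + q.2.2.1)) =
      ∑ d ∈ n.divisors, (((n / d : ℕ) - 1) * F 0 - (d - 1) * F d +
        2 * (((n / d : ℕ) - 1) * F d - ∑ c ∈ Ico 1 d, F c)) := by
  have e1 : ∑ q ∈ quads n with q.1 < q.2.2.1, F (q.1 - q.2.2.1) =
      ∑ q ∈ quads n with q.2.2.1 < q.1, F (q.1 - q.2.2.1) := by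
    simp only [sum_filter]
    rw [← sum_quads_swap]
    refine sum_congr rfl fun q _ => ?_
    rw [← hF, neg_sub]
  have e2 : ∑ q ∈ quads n with q.2.1 < q.2.2.2, F (q.1 + q.2.2.1) =
      ∑ q ∈ quads n with q.2.2.2 < q.2.1, F (q.1 + q.2.2.1) := by
    simp only [sum_filter]
    rw [← sum_quads_swap]
    refine sum_congr rfl fun q _ => ?_
    rw [add_comm]
  have e3 : ∑ q ∈ quads n with q.1 = q.2.2.1, F (q.1 - q.2.2.1) =
      ∑ q ∈ quads n with q.1 = q.2.2.1, F 0 := by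
    refine sum_congr rfl fun q hq => ?_
    rw [(mem_filter.1 hq).2, sub_self]
  have e4 : ∑ q ∈ quads n with q.2.1 = q.2.2.2, F (q.1 + q.2.2.1) =
      ∑ d ∈ n.divisors, (d - 1) * F d := by
    rw [sum_quads_snd_eq n fun a b => F (a + b)]
    refine sum_congr rfl fun d hd => ?_
    have h0 := Nat.pos_of_mem_divisors hd
    rw [sum_congr rfl (g := fun _ => F d)]
    · simp [Nat.cast_sub h0]
    · intro c hc
      rw [← Nat.cast_add, Nat.add_sub_cancel' (mem_Ico.1 hc).2.le]
  have e5 := sum_quads_fst_eq n fun _ => F 0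
  have e6 := sum_quads_fst_eq n fun a => F a
  have e7 := sum_quads_snd_eq n fun a _ => F a
  have e8 := sum_filter_trichotomy (quads n) (fun q => q.1) (fun q => q.2.2.1) fun q => F q.1
  have e9 := sum_filter_trichotomy (quads n) (fun q => q.2.1) (fun q => q.2.2.2) fun q => F q.1
  rw [sum_sub_distrib, sum_filter_trichotomy (quads n) (fun q => q.1) (fun q => q.2.2.1),
    sum_filter_trichotomy (quads n) (fun q => q.2.1) (fun q => q.2.2.2) fun q => F (q.1 + q.2.2.1),
    e1, e2, e3, e4, e5, sum_quads_lt_fst, sum_quads_lt_snd]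
  have e10 := sum_quads_snd_lt n F
  simp only [sum_add_distrib, sum_sub_distrib, ← mul_sum, e6, e7] at *
  linarith

/-- The nontrivial character modulo `3`. -/
def chiThree (n : ℕ) : ℤ := jacobiSym n 3

theorem chiThree_mul (m n : ℕ) : chiThree (m * n) = chiThree m * chiThree n := by
  simp [chiThree, jacobiSym.mul_left]

theorem chiThree_one : chiThree 1 = 1 := by simp [chiThree]

theorem chiThree_mod (n : ℕ) : chiThree n = chiThree (n % 3) := by
  rw [chiThree, chiThree, jacobiSym.mod_left]
  rfl

theorem chiThree_of_mod_zero {n : ℕ} (h : n % 3 = 0) : chiThree n = 0 := by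
  rw [chiThree_mod, h]; norm_num [chiThree]

theorem chiThree_of_mod_one {n : ℕ} (h : n % 3 = 1) : chiThree n = 1 := by
  rw [chiThree_mod, h]; norm_num [chiThree]

theorem chiThree_of_mod_two {n : ℕ} (h : n % 3 = 2) : chiThree n = -1 := by
  rw [chiThree_mod, h]; norm_num [chiThree]

theorem chiThree_mul_eq (a b : ℕ) :
    chiThree a * chiThree b =
      (if (3 : ℤ) ∣ a - b then 1 else 0) - if (3 : ℤ) ∣ a + b then 1 else 0 := by
  have ha : a % 3 = 0 ∨ a % 3 = 1 ∨ a % 3 = 2 := by omega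
  have hb : b % 3 = 0 ∨ b % 3 = 1 ∨ b % 3 = 2 := by omega
  rcases ha with h | h | h <;> rcases hb with h' | h' | h' <;>
  · simp only [chiThree_of_mod_zero, chiThree_of_mod_one, chiThree_of_mod_two, h, h']
    split_ifs <;> omega

theorem sum_Ico_three_dvd (d : ℕ) :
    ∑ c ∈ Ico 1 d, (if (3 : ℤ) ∣ c then 1 else 0 : ℤ) = ((d - 1) / 3 : ℕ) := by
  induction d with
  | zero => simp
  | succ d ih =>
    rcases Nat.eq_zero_or_pos d with rfl | hd
    · simp
    · rw [sum_Ico_succ_top hd, ih]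
      split_ifs <;> omega

theorem sum_divisors_div_three_dvd (n : ℕ) :
    ∑ d ∈ n.divisors, 3 * ((n / d : ℕ) * if (3 : ℤ) ∣ d then 1 else 0 : ℤ) =
      ∑ d ∈ n.divisors, (d * if (3 : ℤ) ∣ d then 1 else 0 : ℤ) := by
  simp only [mul_ite, mul_one, mul_zero, ← sum_filter]
  have key : ∀ d ∈ n.divisors.filter (fun d : ℕ => (3 : ℤ) ∣ d), ∃ e f : ℕ, 0 < e ∧ 0 < f ∧
      d = 3 * e ∧ n = 3 * e * f ∧ n / d = f := by
    intro d hd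
    simp only [mem_filter, Nat.mem_divisors] at hd
    obtain ⟨⟨⟨f, hf⟩, h0⟩, h3⟩ := hd
    obtain ⟨e, rfl⟩ : 3 ∣ d := by exact_mod_cast h3
    subst hf
    refine ⟨e, f, ?_, ?_, rfl, rfl, Nat.mul_div_cancel_left _ ?_⟩
    · rcases Nat.eq_zero_or_pos e with rfl | h
      · simp at h0
      · exact h
    · exact Nat.pos_of_ne_zero (right_ne_zero_of_mul h0)
    · exact Nat.pos_of_ne_zero (left_ne_zero_of_mul h0)
  have maps : ∀ d ∈ n.divisors.filter (fun d : ℕ => (3 : ℤ) ∣ d),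
      3 * (n / d) ∈ n.divisors.filter (fun d : ℕ => (3 : ℤ) ∣ d) := by
    intro d hd
    obtain ⟨e, f, he, hf, rfl, hn, h⟩ := key d hd
    rw [h]
    simp only [mem_filter, Nat.mem_divisors]
    refine ⟨⟨⟨e, by rw [hn]; ring⟩, ?_⟩, by exact_mod_cast Dvd.intro _ rfl⟩
    rw [hn]; positivity
  have inv : ∀ d ∈ n.divisors.filter (fun d : ℕ => (3 : ℤ) ∣ d), 3 * (n / (3 * (n / d))) = d := by
    intro d hd
    obtain ⟨e, f, he, hf, rfl, hn, h⟩ := key d hd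
    rw [h, hn, show 3 * e * f = 3 * f * e by ring, Nat.mul_div_cancel_left _ (by positivity)]
  refine sum_nbij' (fun d => 3 * (n / d)) (fun d => 3 * (n / d)) maps maps inv inv ?_
  intro d _
  push_cast
  rfl

theorem three_mul_sum_quads (n : ℕ) :
    3 * ∑ q ∈ quads n, chiThree q.1 * chiThree q.2.2.1 + ∑ d ∈ n.divisors, chiThree d =
      ∑ d ∈ n.divisors, if 3 ∣ d then 0 else (d : ℤ) := by
  simp only [chiThree_mul_eq]
  rw [sum_quads_sub_sub_add n fun x => if (3 : ℤ) ∣ x then 1 else 0]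
  swap
  · simp
  have h1 : ∑ d ∈ n.divisors, ((n / d : ℕ) : ℤ) = ∑ d ∈ n.divisors, (d : ℤ) := by
    rw [← Nat.cast_sum, ← Nat.cast_sum, Nat.sum_div_divisors n fun d => d]
  have h2 := sum_divisors_div_three_dvd n
  have h3 : ∑ d ∈ n.divisors, (3 * ((d - 1) - (d - 1) * (if (3 : ℤ) ∣ d then 1 else 0)
        - 2 * ((if (3 : ℤ) ∣ d then 1 else 0) + ((d - 1) / 3 : ℕ)))
        + 2 * (d * if (3 : ℤ) ∣ d then 1 else 0) + chiThree d) =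
      ∑ d ∈ n.divisors, if 3 ∣ d then 0 else (d : ℤ) := by
    refine sum_congr rfl fun d hd => ?_
    have h0 := Nat.pos_of_mem_divisors hd
    have : d % 3 = 0 ∨ d % 3 = 1 ∨ d % 3 = 2 := by omega
    rcases this with h | h | h
    · rw [chiThree_of_mod_zero h, if_pos (by omega), if_pos (by omega)]; omega
    · rw [chiThree_of_mod_one h, if_neg (by omega), if_neg (by omega)]; omega
    · rw [chiThree_of_mod_two h, if_neg (by omega), if_neg (by omega)]; omega
  rw [← h3]
  simp only [sum_Ico_three_dvd, dvd_zero, if_true, mul_one, sub_mul, one_mul, mul_add, mul_sub,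
    sum_add_distrib, sum_sub_distrib, ← mul_sum, h1,
    sum_const, nsmul_eq_mul] at h2 ⊢
  linarith

/-- The number of ideals of norm `n` in the ring of Eisenstein integers, `∑_{d ∣ n} χ(d)`. -/
def tauThree (n : ℕ) : ℤ := ∑ d ∈ n.divisors, chiThree d

theorem tauThree_mul_eq_sum {a b : ℕ} (ha : 0 < a) (hb : 0 < b) :
    tauThree (a * b) = ∑ d ∈ a.divisors ×ˢ b.divisors with Nat.Coprime d.2 (a / d.1),
      chiThree d.1 * chiThree d.2 := by
  symm
  refine sum_nbij' (fun d => d.1 * d.2) (fun d => (d.gcd a, d / d.gcd a)) ?_ ?_ ?_ ?_ ?_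
  · rintro ⟨c, d⟩
    simp only [mem_filter, mem_product, Nat.mem_divisors]
    rintro ⟨⟨⟨h1, -⟩, h2, -⟩, -⟩
    exact ⟨mul_dvd_mul h1 h2, by positivity⟩
  · intro d
    simp only [mem_filter, mem_product, Nat.mem_divisors]
    rintro ⟨h, -⟩
    have hg : 0 < d.gcd a := Nat.gcd_pos_of_pos_right _ ha
    have hc := Nat.coprime_div_gcd_div_gcd hg
    refine ⟨⟨⟨Nat.gcd_dvd_right _ _, ha.ne'⟩, ?_, hb.ne'⟩, hc⟩
    refine hc.dvd_of_dvd_mul_left ?_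
    rw [← Nat.mul_dvd_mul_iff_left hg, Nat.mul_div_cancel' (Nat.gcd_dvd_left _ _), ← mul_assoc,
      Nat.mul_div_cancel' (Nat.gcd_dvd_right _ _)]
    exact h
  · rintro ⟨c, d⟩
    simp only [mem_filter, mem_product, Nat.mem_divisors]
    rintro ⟨⟨⟨⟨k, rfl⟩, -⟩, h2, -⟩, h⟩
    have hc : 0 < c := Nat.pos_of_mul_pos_right ha
    rw [Nat.mul_div_cancel_left _ hc] at h
    rw [Nat.gcd_mul_left, h.gcd_eq_one, mul_one, Nat.mul_div_cancel_left _ hc]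
  · intro d _
    exact Nat.mul_div_cancel' (Nat.gcd_dvd_left _ _)
  · intro d _
    exact (chiThree_mul _ _).symm

theorem tauThree_mul_tauThree {a b : ℕ} (ha : 0 < a) (hb : 0 < b) :
    tauThree a * tauThree b =
      ∑ e ∈ (a.gcd b).divisors, chiThree e * tauThree (a / e * (b / e)) := by
  have h : ∀ e ∈ (a.gcd b).divisors, chiThree e * tauThree (a / e * (b / e)) =
      ∑ d ∈ (a / e).divisors ×ˢ (b / e).divisors with Nat.Coprime d.2 (a / e / d.1),
        chiThree e * (chiThree d.1 * chiThree d.2) := by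
    intro e he
    have h1 := Nat.dvd_of_mem_divisors he
    have h0 := Nat.pos_of_mem_divisors he
    rw [tauThree_mul_eq_sum, mul_sum]
    · exact Nat.div_pos (Nat.le_of_dvd ha (h1.trans (Nat.gcd_dvd_left _ _))) h0
    · exact Nat.div_pos (Nat.le_of_dvd hb (h1.trans (Nat.gcd_dvd_right _ _))) h0
  rw [sum_congr rfl h, sum_sigma', tauThree, tauThree, sum_mul_sum, ← sum_product']
  refine sum_nbij' (fun d => ⟨d.2.gcd (a / d.1), d.1, d.2 / d.2.gcd (a / d.1)⟩)
    (fun s => (s.2.1, s.1 * s.2.2)) ?_ ?_ ?_ ?_ ?_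
  · rintro ⟨c, d⟩
    simp only [mem_filter, mem_product, Nat.mem_divisors, mem_sigma]
    rintro ⟨⟨⟨k, rfl⟩, -⟩, ⟨l, rfl⟩, -⟩
    have hc : 0 < c := Nat.pos_of_mul_pos_right ha
    have hk : 0 < k := Nat.pos_of_mul_pos_left ha
    have hd : 0 < d := Nat.pos_of_mul_pos_right hb
    have hl : 0 < l := Nat.pos_of_mul_pos_left hb
    rw [Nat.mul_div_cancel_left _ hc]
    have hg : 0 < d.gcd k := Nat.gcd_pos_of_pos_right _ hk
    have hco := Nat.coprime_div_gcd_div_gcd hg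
    obtain ⟨u, hu⟩ := Nat.gcd_dvd_left d k
    obtain ⟨v, hv⟩ := Nat.gcd_dvd_right d k
    generalize d.gcd k = g at *
    subst hu hv
    rw [Nat.mul_div_cancel_left _ hg, Nat.mul_div_cancel_left _ hg] at hco
    have e1 : c * (g * v) / g = c * v := by
      rw [show c * (g * v) = g * (c * v) by ring, Nat.mul_div_cancel_left _ hg]
    have e2 : g * u * l / g = u * l := by
      rw [show g * u * l = g * (u * l) by ring, Nat.mul_div_cancel_left _ hg]
    rw [Nat.mul_div_cancel_left _ hg, e1, e2, Nat.mul_div_cancel_left _ hc]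
    have hu : 0 < u := Nat.pos_of_mul_pos_left hd
    have hv : 0 < v := Nat.pos_of_mul_pos_left hk
    refine ⟨⟨Nat.dvd_gcd ⟨c * v, by ring⟩ ⟨u * l, by ring⟩, ?_⟩, ⟨⟨⟨v, rfl⟩, by positivity⟩,
      ⟨l, rfl⟩, by positivity⟩, hco⟩
    exact (Nat.gcd_pos_of_pos_left _ ha).ne'
  · rintro ⟨e, c, d⟩
    simp only [mem_filter, mem_product, Nat.mem_divisors, mem_sigma]
    rintro ⟨⟨he, -⟩, ⟨⟨h1, -⟩, h2, -⟩, -⟩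
    refine ⟨⟨h1.trans (Nat.div_dvd_of_dvd (he.trans (Nat.gcd_dvd_left _ _))), ha.ne'⟩, ?_, hb.ne'⟩
    have := mul_dvd_mul_left e h2
    rwa [Nat.mul_div_cancel' (he.trans (Nat.gcd_dvd_right _ _))] at this
  · rintro ⟨c, d⟩ _
    simp only [Nat.mul_div_cancel' (Nat.gcd_dvd_left _ _)]
  · rintro ⟨e, c, d⟩
    simp only [mem_filter, mem_product, Nat.mem_divisors, mem_sigma]
    rintro ⟨⟨hdvd, -⟩, ⟨⟨h1, -⟩, h2, -⟩, h⟩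
    have h3 := hdvd.trans (Nat.gcd_dvd_left _ _)
    obtain ⟨k, rfl⟩ := h3
    have he : 0 < e := Nat.pos_of_mul_pos_right ha
    have hk : 0 < k := Nat.pos_of_mul_pos_left ha
    rw [Nat.mul_div_cancel_left _ he] at h h1
    obtain ⟨l, rfl⟩ := h1
    have hc : 0 < c := Nat.pos_of_mul_pos_right hk
    rw [Nat.mul_div_cancel_left _ hc] at h
    rw [show e * (c * l) = c * (e * l) by ring, Nat.mul_div_cancel_left _ hc, Nat.gcd_mul_left,
      h.gcd_eq_one, mul_one, Nat.mul_div_cancel_left _ he]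
  · rintro ⟨c, d⟩ _
    simp only
    conv_lhs => rw [← Nat.mul_div_cancel' (Nat.gcd_dvd_left d (a / c)), chiThree_mul]
    ring

theorem sum_quads_chiThree (n : ℕ) :
    ∑ q ∈ quads n, chiThree q.1 * chiThree q.2.2.1 =
      ∑ a ∈ Ioo 0 n, tauThree a * tauThree (n - a) := by
  simp only [tauThree, sum_mul_sum, ← sum_product']
  rw [sum_sigma']
  refine sum_nbij' (fun q => ⟨q.1 * q.2.1, q.1, q.2.2.1⟩)
    (fun s => (s.2.1, s.1 / s.2.1, s.2.2, (n - s.1) / s.2.2)) ?_ ?_ ?_ ?_ ?_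
  · rintro ⟨a, x, b, y⟩
    simp only [mem_quads, mem_product, Nat.mem_divisors, mem_sigma, mem_Ioo]
    rintro ⟨h1, h2, h3, h4, rfl⟩
    have := Nat.mul_pos h1 h2
    have := Nat.mul_pos h3 h4
    rw [Nat.add_sub_cancel_left]
    refine ⟨⟨?_, ?_⟩, ⟨⟨x, rfl⟩, ?_⟩, ⟨y, rfl⟩, ?_⟩ <;> omega
  · rintro ⟨m, a, b⟩
    simp only [mem_quads, mem_product, Nat.mem_divisors, mem_sigma, mem_Ioo]
    rintro ⟨⟨h1, h2⟩, ⟨h3, -⟩, h4, h5⟩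
    have h5 := Nat.pos_of_ne_zero h5
    rw [Nat.mul_div_cancel' h3, Nat.mul_div_cancel' h4]
    have ha := Nat.pos_of_dvd_of_pos h3 h1
    have hb := Nat.pos_of_dvd_of_pos h4 h5
    exact ⟨ha, Nat.div_pos (Nat.le_of_dvd h1 h3) ha, hb,
      Nat.div_pos (Nat.le_of_dvd h5 h4) hb, by omega⟩
  · rintro ⟨a, x, b, y⟩
    simp only [mem_quads]
    rintro ⟨h1, h2, h3, h4, rfl⟩
    rw [Nat.add_sub_cancel_left, Nat.mul_div_cancel_left _ h1, Nat.mul_div_cancel_left _ h3]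
  · rintro ⟨m, a, b⟩
    simp only [mem_product, Nat.mem_divisors, mem_sigma]
    rintro ⟨-, ⟨h3, -⟩, -⟩
    rw [Nat.mul_div_cancel' h3]
  · rintro ⟨a, x, b, y⟩ _
    rfl

/-- The sum of `tauThree (a * b)` over the positive solutions of `a + b = n`. -/
def mulSum (n : ℕ) : ℤ := ∑ a ∈ Ioo 0 n, tauThree (a * (n - a))

theorem sum_tauThree_mul_tauThree (n : ℕ) :
    ∑ a ∈ Ioo 0 n, tauThree a * tauThree (n - a) =
      ∑ e ∈ n.divisors, chiThree e * mulSum (n / e) := by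
  have h : ∀ a ∈ Ioo 0 n, tauThree a * tauThree (n - a) =
      ∑ e ∈ (a.gcd (n - a)).divisors, chiThree e * tauThree (a / e * ((n - a) / e)) := by
    intro a ha
    rw [mem_Ioo] at ha
    exact tauThree_mul_tauThree ha.1 (by omega)
  simp only [mulSum, mul_sum]
  rw [sum_congr rfl h, sum_sigma', sum_sigma']
  refine sum_nbij' (fun s => ⟨s.2, s.1 / s.2⟩) (fun s => ⟨s.1 * s.2, s.1⟩) ?_ ?_ ?_ ?_ ?_
  · rintro ⟨a, e⟩
    simp only [Nat.mem_divisors, mem_sigma, mem_Ioo]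
    rintro ⟨⟨h1, h2⟩, h3, -⟩
    obtain ⟨k, rfl⟩ := h3.trans (Nat.gcd_dvd_left _ _)
    obtain ⟨l, hl⟩ := h3.trans (Nat.gcd_dvd_right _ _)
    have hn : n = e * (k + l) := by rw [mul_add]; omega
    have he : 0 < e := Nat.pos_of_mul_pos_right h1
    subst hn
    rw [Nat.mul_div_cancel_left _ he, Nat.mul_div_cancel_left _ he]
    refine ⟨⟨⟨_, rfl⟩, by omega⟩, Nat.pos_of_mul_pos_left h1, lt_of_mul_lt_mul_left h2 he.le⟩
  · rintro ⟨e, a⟩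
    simp only [Nat.mem_divisors, mem_sigma, mem_Ioo]
    rintro ⟨⟨⟨k, rfl⟩, h0⟩, h1, h2⟩
    have he : 0 < e := Nat.pos_of_ne_zero (left_ne_zero_of_mul h0)
    rw [Nat.mul_div_cancel_left _ he] at h2
    have := Nat.mul_pos he h1
    refine ⟨⟨this, Nat.mul_lt_mul_of_pos_left h2 he⟩, ?_, (Nat.gcd_pos_of_pos_left _ this).ne'⟩
    rw [← Nat.mul_sub]
    exact Nat.dvd_gcd (Dvd.intro _ rfl) (Dvd.intro _ rfl)
  · rintro ⟨a, e⟩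
    simp only [Nat.mem_divisors, mem_sigma]
    rintro ⟨-, h3, -⟩
    rw [Nat.mul_div_cancel' (h3.trans (Nat.gcd_dvd_left _ _))]
  · rintro ⟨e, a⟩
    simp only [Nat.mem_divisors, mem_sigma]
    rintro ⟨⟨⟨k, rfl⟩, h0⟩, -⟩
    rw [Nat.mul_div_cancel_left _ (Nat.pos_of_ne_zero (left_ne_zero_of_mul h0))]
  · rintro ⟨a, e⟩
    simp only [Nat.mem_divisors, mem_sigma, mem_Ioo]
    rintro ⟨⟨h1, h2⟩, h3, -⟩
    obtain ⟨k, rfl⟩ := h3.trans (Nat.gcd_dvd_left _ _)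
    obtain ⟨l, hl⟩ := h3.trans (Nat.gcd_dvd_right _ _)
    have hn : n = e * (k + l) := by rw [mul_add]; omega
    have he : 0 < e := Nat.pos_of_mul_pos_right h1
    rw [hl, hn]
    simp only [Nat.mul_div_cancel_left _ he, Nat.add_sub_cancel_left]

/-- `chiThree` as an arithmetic function. -/
def chiThreeArith : ArithmeticFunction ℤ :=
  ⟨chiThree, chiThree_of_mod_zero rfl⟩

/-- The arithmetic function `1 + 3 * mulSum`. -/
def mulSumArith : ArithmeticFunction ℤ :=
  ⟨fun n => if n = 0 then 0 else 1 + 3 * mulSum n, if_pos rfl⟩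

/-- The function equal to `n` when `3 ∤ n` and to `0` otherwise. -/
def idPrimeToThree : ArithmeticFunction ℤ :=
  ⟨fun n => if 3 ∣ n then 0 else (n : ℤ), by simp⟩

open ArithmeticFunction ArithmeticFunction.zeta ArithmeticFunction.Moebius in
theorem chiThreeArith_mul_mulSumArith :
    chiThreeArith * mulSumArith = (ζ : ArithmeticFunction ℤ) * idPrimeToThree := by
  ext n
  rw [coe_zeta_mul_apply, mul_apply]
  have h1 := three_mul_sum_quads n
  rw [sum_quads_chiThree, sum_tauThree_mul_tauThree] at h1
  have h2 : ∑ x ∈ n.divisorsAntidiagonal, chiThreeArith x.1 * mulSumArith x.2 =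
      ∑ x ∈ n.divisorsAntidiagonal, chiThree x.1 * (1 + 3 * mulSum x.2) := by
    refine sum_congr rfl fun x hx => ?_
    have : x.2 ≠ 0 := by
      rintro h
      simp [h, eq_comm] at hx
    simp [chiThreeArith, mulSumArith, this]
  have h3 : ∑ d ∈ n.divisors, idPrimeToThree d = ∑ d ∈ n.divisors, if 3 ∣ d then 0 else (d : ℤ) :=
    rfl
  rw [h2, h3, ← h1, Nat.sum_divisorsAntidiagonal fun a b => chiThree a * (1 + 3 * mulSum b),
    mul_sum, ← sum_add_distrib]
  refine sum_congr rfl fun d _ => ?_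
  ring

open ArithmeticFunction ArithmeticFunction.zeta ArithmeticFunction.Moebius in
theorem moebius_pmul_chiThreeArith_mul :
    (pmul (μ : ArithmeticFunction ℤ) chiThreeArith) * chiThreeArith = 1 := by
  ext n
  rw [mul_apply]
  have : ∑ x ∈ n.divisorsAntidiagonal, (pmul (μ : ArithmeticFunction ℤ) chiThreeArith) x.1 *
      chiThreeArith x.2 = chiThree n * (μ * (ζ : ArithmeticFunction ℤ)) n := by
    rw [mul_apply, mul_sum]
    refine sum_congr rfl fun x hx => ?_
    rw [Nat.mem_divisorsAntidiagonal] at hx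
    have h0 : x.2 ≠ 0 := by
      rintro h
      simp [h, eq_comm] at hx
    have h (m : ℕ) : chiThreeArith m = chiThree m := rfl
    rw [← hx.1, chiThree_mul, pmul_apply, h, h, natCoe_apply, zeta_apply_ne h0]
    simp
    ring
  rw [this, moebius_mul_coe_zeta, one_apply]
  split_ifs with h
  · rw [h, chiThree_one, one_mul]
  · rw [mul_zero]

theorem isMultiplicative_chiThreeArith : chiThreeArith.IsMultiplicative :=
  ⟨chiThree_one, fun _ => chiThree_mul _ _⟩

theorem isMultiplicative_idPrimeToThree : idPrimeToThree.IsMultiplicative := by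
  refine ⟨by simp [idPrimeToThree], fun {m n} _ => ?_⟩
  simp only [idPrimeToThree, ArithmeticFunction.coe_mk, Nat.prime_three.dvd_mul]
  by_cases h : 3 ∣ m <;> by_cases h' : 3 ∣ n <;> simp [h, h']

open ArithmeticFunction ArithmeticFunction.zeta ArithmeticFunction.Moebius in
theorem isMultiplicative_mulSumArith : mulSumArith.IsMultiplicative := by
  have h : mulSumArith = (pmul (μ : ArithmeticFunction ℤ) chiThreeArith) *
      ((ζ : ArithmeticFunction ℤ) * idPrimeToThree) := by
    rw [← chiThreeArith_mul_mulSumArith, ← mul_assoc, moebius_pmul_chiThreeArith_mul, one_mul]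
  rw [h]
  exact (isMultiplicative_moebius.pmul isMultiplicative_chiThreeArith).mul
    (isMultiplicative_zeta.natCast.mul isMultiplicative_idPrimeToThree)

open ArithmeticFunction ArithmeticFunction.zeta ArithmeticFunction.Moebius in
theorem mulSumArith_prime_pow_succ {p : ℕ} (hp : p.Prime) (hp3 : p ≠ 3) (k : ℕ) :
    mulSumArith (p ^ (k + 1)) =
      ∑ i ∈ range (k + 2), (p : ℤ) ^ i - chiThree p * ∑ i ∈ range (k + 1), (p : ℤ) ^ i := by
  have key : ∀ k, ∑ i ∈ range (k + 1), (p : ℤ) ^ i =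
      ∑ i ∈ range (k + 1), chiThree (p ^ i) * mulSumArith (p ^ (k - i)) := by
    intro k
    have h := DFunLike.congr_fun chiThreeArith_mul_mulSumArith (p ^ k)
    rw [coe_zeta_mul_apply, mul_apply] at h
    rw [Nat.sum_divisorsAntidiagonal fun a b => chiThreeArith a * mulSumArith b,
      Nat.sum_divisors_prime_pow hp, Nat.sum_divisors_prime_pow hp] at h
    have h1 : ∑ i ∈ range (k + 1), idPrimeToThree (p ^ i) = ∑ i ∈ range (k + 1), (p : ℤ) ^ i := by
      refine sum_congr rfl fun i _ => ?_
      have : ¬ 3 ∣ p ^ i := fun h =>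
        hp3 ((Nat.prime_dvd_prime_iff_eq Nat.prime_three hp).1 (Nat.prime_three.dvd_of_dvd_pow h)).symm
      simp [idPrimeToThree, this]
    rw [← h1, ← h]
    refine sum_congr rfl fun i hi => ?_
    rw [Nat.pow_div (by rw [mem_range] at hi; omega) hp.pos]
    rfl
  rw [key (k + 1), key k, sum_range_succ', mul_sum]
  simp only [pow_succ p, chiThree_mul, Nat.add_sub_add_right, pow_zero, chiThree_one]
  rw [sum_congr rfl fun i _ => show chiThree (p ^ i) * chiThree p * mulSumArith (p ^ (k - i)) =
    chiThree p * (chiThree (p ^ i) * mulSumArith (p ^ (k - i))) by ring]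
  simp [pow_succ]

theorem jacobiSym_neg_three {p : ℕ} (hp : Odd p) : jacobiSym (-3) p = chiThree p := by
  rw [chiThree, jacobiSym.neg _ hp]
  have h3 : Odd 3 := by decide
  have := jacobiSym.quadratic_reciprocity_if (a := 3) (b := p) rfl (Nat.odd_iff.1 hp)
  rcases Nat.odd_mod_four_iff.1 (Nat.odd_iff.1 hp) with h | h
  · rw [ZMod.χ₄_nat_one_mod_four h, one_mul]
    simpa [h] using this.symm
  · rw [ZMod.χ₄_nat_three_mod_four h]
    simp [h] at this
    simpa using neg_eq_iff_eq_neg.2 this.symm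

theorem tHp_eq_mulSumArith {p : ℕ} (hp : p.Prime) (hp2 : p ≠ 2) (hp3 : p ≠ 3) (k : ℕ) :
    tHp 1 1 3 p k = mulSumArith (p ^ k) := by
  have h1 : ((p : ℤ) - 1) ≠ 0 := by
    have := hp.one_lt
    omega
  have h2 : ∀ n, ((p : ℤ) ^ n - 1) / ((p : ℤ) - 1) = ∑ i ∈ range n, (p : ℤ) ^ i := by
    intro n
    rw [← mul_geom_sum, Int.mul_ediv_cancel_left _ h1]
  rw [tHp, h2, h2, show (-(1 * 1 * 3) : ℤ) = -3 by norm_num,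
    jacobiSym_neg_three (hp.odd_of_ne_two hp2)]
  cases k with
  | zero => simp [isMultiplicative_mulSumArith.map_one]
  | succ k => rw [mulSumArith_prime_pow_succ hp hp3]

theorem prod_tHp {n : ℕ} (hn : n.Coprime 6) :
    ∏ p ∈ n.primeFactors, tHp 1 1 3 p (n.factorization p) = mulSumArith n := by
  have h0 : n ≠ 0 := by
    rintro rfl
    norm_num at hn
  rw [isMultiplicative_mulSumArith.multiplicative_factorization _ h0, Finsupp.prod,
    Nat.support_factorization]
  refine prod_congr rfl fun p hp => ?_
  have hp' := Nat.dvd_of_mem_primeFactors hp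
  refine tHp_eq_mulSumArith (Nat.prime_of_mem_primeFactors hp) ?_ ?_ _ <;> rintro rfl
  · exact absurd (Nat.dvd_gcd hp' (by norm_num : 2 ∣ 6)) (by rw [hn.gcd_eq_one]; norm_num)
  · exact absurd (Nat.dvd_gcd hp' (by norm_num : 3 ∣ 6)) (by rw [hn.gcd_eq_one]; norm_num)

theorem tauThree_one : tauThree 1 = 1 := by simp [tauThree, chiThree_one]

theorem tauThree_prime_mul {p m : ℕ} (hp : p.Prime) (hm : 0 < m) :
    tauThree (p * m) = (1 + chiThree p) * tauThree m -
      chiThree p * if p ∣ m then tauThree (m / p) else 0 := by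
  have h := tauThree_mul_tauThree hp.pos hm
  have h1 : tauThree p = 1 + chiThree p := by
    rw [tauThree, hp.sum_divisors, chiThree_one, add_comm]
  rw [h1] at h
  rw [h]
  split_ifs with hd
  · rw [Nat.gcd_eq_left hd, hp.sum_divisors, Nat.div_self hp.pos, Nat.div_one, Nat.div_one, one_mul,
      chiThree_one]
    ring
  · rw [((Nat.Prime.coprime_iff_not_dvd hp).2 hd).gcd_eq_one]
    simp [chiThree_one]

theorem tauThree_four_mul {m : ℕ} (hm : 0 < m) : tauThree (4 * m) = tauThree m := by
  rw [show 4 * m = 2 * (2 * m) by ring, tauThree_prime_mul Nat.prime_two (by positivity),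
    chiThree_of_mod_two rfl]
  simp

/-- The number of elements of `ℤ√(-3)` of norm `m`. -/
noncomputable def normCount (m : ℤ) : ℕ := Set.ncard {z : ℤ√(-3) | z.norm = m}

theorem norm_eq_sq_add (z : ℤ√(-3)) : z.norm = z.re ^ 2 + 3 * z.im ^ 2 := by
  rw [Zsqrtd.norm_def]; ring

theorem finite_norm_eq (m : ℤ) : {z : ℤ√(-3) | z.norm = m}.Finite := by
  refine Set.Finite.subset (((Icc (-m) m ×ˢ Icc (-m) m).finite_toSet).image
    fun p : ℤ × ℤ => (⟨p.1, p.2⟩ : ℤ√(-3))) ?_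
  intro z hz
  rw [Set.mem_ofPred_eq, norm_eq_sq_add] at hz
  refine ⟨(z.re, z.im), ?_, rfl⟩
  simp only [coe_product, coe_Icc, Set.mem_prod, Set.mem_Icc]
  refine ⟨⟨?_, ?_⟩, ?_, ?_⟩ <;> nlinarith [sq_nonneg z.re, sq_nonneg z.im,
    Int.le_self_sq z.re, Int.le_self_sq (-z.re), Int.le_self_sq z.im, Int.le_self_sq (-z.im)]

theorem mul_left_injective_of_norm_ne_zero {w : ℤ√(-3)} (hw : w.norm ≠ 0) :
    Function.Injective fun z => w * z := by
  intro x y h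
  have h : w * (x - y) = 0 := by rw [mul_sub, sub_eq_zero]; exact h
  have h2 := congrArg (fun z => star w * z) h
  simp only [← mul_assoc, mul_zero] at h2
  rw [mul_comm (star w) w, ← Zsqrtd.norm_eq_mul_conj] at h2
  have h3 := congrArg Zsqrtd.re h2
  have h4 := congrArg Zsqrtd.im h2
  rw [Zsqrtd.re_smul] at h3
  rw [Zsqrtd.im_smul] at h4
  rw [← sub_eq_zero]
  refine Zsqrtd.ext ?_ ?_
  · simpa [hw] using h3
  · simpa [hw] using h4

theorem ncard_image_mul {w : ℤ√(-3)} (hw : w.norm ≠ 0) (m : ℤ) :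
    ((fun z => w * z) '' {z : ℤ√(-3) | z.norm = m}).ncard = normCount m :=
  Set.ncard_image_of_injective _ (mul_left_injective_of_norm_ne_zero hw)

theorem normCount_eq_of_forall_dvd {w : ℤ√(-3)} (hw : w.norm ≠ 0) (m : ℤ)
    (h : ∀ z : ℤ√(-3), z.norm = w.norm * m → w ∣ z) :
    normCount (w.norm * m) = normCount m := by
  rw [← ncard_image_mul hw m]
  refine congrArg Set.ncard (Set.ext fun z => ?_)
  constructor
  · intro hz
    obtain ⟨y, rfl⟩ := h z hz
    refine ⟨y, ?_, rfl⟩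
    rw [Set.mem_ofPred_eq, Zsqrtd.norm_mul] at hz
    exact mul_left_cancel₀ hw hz
  · rintro ⟨y, hy, rfl⟩
    rw [Set.mem_ofPred_eq] at hy ⊢
    rw [Zsqrtd.norm_mul, hy]

theorem normCount_three_mul (m : ℤ) : normCount (3 * m) = normCount m := by
  have hw : (Zsqrtd.sqrtd : ℤ√(-3)).norm = 3 := by simp [Zsqrtd.norm_def]
  have := normCount_eq_of_forall_dvd (w := Zsqrtd.sqrtd) (by rw [hw]; norm_num) m ?_
  · rwa [hw] at this
  · intro z hz
    rw [hw, norm_eq_sq_add] at hz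
    have h3 : (3 : ℤ) ∣ z.re := by
      refine Int.prime_three.dvd_of_dvd_pow (n := 2) ?_
      exact ⟨m - z.im ^ 2, by linarith⟩
    obtain ⟨k, hk⟩ := h3
    refine ⟨⟨z.im, -k⟩, Zsqrtd.ext ?_ ?_⟩ <;> simp [hk]

theorem normCount_eight_mul (m : ℤ) : normCount (8 * m) = normCount (2 * m) := by
  have hw : (2 : ℤ√(-3)).norm = 4 := by simp [Zsqrtd.norm_def]
  have := normCount_eq_of_forall_dvd (w := 2) (by rw [hw]; norm_num) (2 * m) ?_
  · rwa [hw, show 4 * (2 * m) = 8 * m by ring] at this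
  · intro z hz
    rw [hw, norm_eq_sq_add] at hz
    rw [show (2 : ℤ√(-3)) = ((2 : ℤ) : ℤ√(-3)) by norm_cast, Zsqrtd.intCast_dvd]
    rcases Int.even_or_odd' z.re with ⟨a, ha | ha⟩ <;>
    rcases Int.even_or_odd' z.im with ⟨b, hb | hb⟩ <;> rw [ha, hb] at hz
    · exact ⟨⟨a, ha⟩, ⟨b, hb⟩⟩
    · ring_nf at hz; omega
    · ring_nf at hz; omega
    · have h1 : 2 ∣ a * (a + 1) := even_iff_two_dvd.1 (Int.even_mul_succ_self a)
      have h2 : 2 ∣ b * (b + 1) := even_iff_two_dvd.1 (Int.even_mul_succ_self b)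
      ring_nf at hz h1 h2; omega

theorem norm_ne_two_mul_odd (z : ℤ√(-3)) {m : ℤ} (hm : Odd m) : z.norm ≠ 2 * m := by
  obtain ⟨k, rfl⟩ := hm
  intro hz
  rw [norm_eq_sq_add] at hz
  rcases Int.even_or_odd' z.re with ⟨a, ha | ha⟩ <;>
  rcases Int.even_or_odd' z.im with ⟨b, hb | hb⟩ <;> rw [ha, hb] at hz <;> ring_nf at hz <;> omega

theorem normCount_zero : normCount 0 = 1 := by
  rw [normCount, Set.ncard_eq_one]
  refine ⟨0, Set.ext fun z => ?_⟩
  rw [Set.mem_ofPred_eq, Set.mem_singleton_iff, norm_eq_sq_add]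
  constructor
  · intro h
    have h1 : z.re = 0 := by nlinarith [sq_nonneg z.re, sq_nonneg z.im]
    have h2 : z.im = 0 := by nlinarith [sq_nonneg z.re, sq_nonneg z.im]
    exact Zsqrtd.ext h1 h2
  · rintro rfl
    simp

theorem normCount_one : normCount 1 = 2 := by
  rw [normCount, Set.ncard_eq_two]
  refine ⟨1, -1, by decide, Set.ext fun z => ?_⟩
  rw [Set.mem_ofPred_eq, norm_eq_sq_add]
  simp only [Set.mem_insert_iff, Set.mem_singleton_iff, Zsqrtd.ext_iff]
  constructor
  · intro h
    have h1 : z.re ≤ 1 := by nlinarith [sq_nonneg z.im]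
    have h2 : -1 ≤ z.re := by nlinarith [sq_nonneg z.im]
    have h3 : z.im = 0 := by
      by_contra h0
      have : 0 < z.im ^ 2 := by positivity
      nlinarith [sq_nonneg z.re]
    rw [h3] at h ⊢
    generalize z.re = a at *
    interval_cases a <;> simp_all
  · rintro (⟨h, h'⟩ | ⟨h, h'⟩) <;> simp [h, h']

theorem normCount_four : normCount 4 = 6 := by
  have : {z : ℤ√(-3) | z.norm = 4} =
      (({⟨2, 0⟩, ⟨-2, 0⟩, ⟨1, 1⟩, ⟨1, -1⟩, ⟨-1, 1⟩, ⟨-1, -1⟩} : Finset (ℤ√(-3))) : Set (ℤ√(-3))) := by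
    ext z
    rw [Set.mem_ofPred_eq, norm_eq_sq_add]
    simp only [coe_insert, coe_singleton, Set.mem_insert_iff, Set.mem_singleton_iff, Zsqrtd.ext_iff]
    constructor
    · intro h
      have h1 : z.re ≤ 2 := by nlinarith [sq_nonneg z.im]
      have h2 : -2 ≤ z.re := by nlinarith [sq_nonneg z.im]
      have h3 : z.im ≤ 1 := by nlinarith [sq_nonneg z.re]
      have h4 : -1 ≤ z.im := by nlinarith [sq_nonneg z.re]
      generalize z.re = a at *
      generalize z.im = b at *
      interval_cases a <;> interval_cases b <;> simp_all
    · rintro (⟨h, h'⟩ | ⟨h, h'⟩ | ⟨h, h'⟩ | ⟨h, h'⟩ | ⟨h, h'⟩ | ⟨h, h'⟩) <;> rw [h, h'] <;> norm_num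
  rw [normCount, this, Set.ncard_coe_finset]
  decide

theorem ncard_norm_eq_and_dvd {p : ℕ} (hp : 0 < p) (m : ℕ) :
    {z : ℤ√(-3) | z.norm = (p * m : ℕ) ∧ ((p : ℤ) : ℤ√(-3)) ∣ z}.ncard =
      if p ∣ m then normCount (m / p : ℕ) else 0 := by
  have hn : ((p : ℤ) : ℤ√(-3)).norm = p * p := by rw [Zsqrtd.norm_intCast]
  have hp0 : (p : ℤ) ≠ 0 := by positivity
  have key (y : ℤ√(-3)) : (((p : ℤ) : ℤ√(-3)) * y).norm = (p * m : ℕ) ↔ p * y.norm = m := by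
    rw [Zsqrtd.norm_mul, hn, Nat.cast_mul, mul_assoc, mul_right_inj' hp0]
  split_ifs with hd
  · obtain ⟨k, rfl⟩ := hd
    rw [Nat.mul_div_cancel_left _ hp,
      ← ncard_image_mul (w := ((p : ℤ) : ℤ√(-3))) (by rw [hn]; positivity)]
    refine congrArg Set.ncard (Set.ext fun z => ?_)
    have key' (y : ℤ√(-3)) : (p : ℤ) * y.norm = (p * k : ℕ) ↔ y.norm = k := by
      rw [Nat.cast_mul, mul_right_inj' hp0]
    constructor
    · rintro ⟨hz, y, rfl⟩
      exact ⟨y, (key' y).1 ((key y).1 hz), rfl⟩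
    · rintro ⟨y, hy, rfl⟩
      exact ⟨(key y).2 ((key' y).2 hy), Dvd.intro _ rfl⟩
  · rw [Set.ncard_eq_zero ((finite_norm_eq _).subset fun z hz => hz.1),
      Set.eq_empty_iff_forall_notMem]
    rintro _ ⟨hz, y, rfl⟩
    exact hd (by exact_mod_cast Dvd.intro _ ((key y).1 hz))

theorem normCount_inert {p : ℕ} [Fact p.Prime] (h : legendreSym p (-3) = -1) (m : ℕ) :
    normCount (p * m : ℕ) = if p ∣ m then normCount (m / p : ℕ) else 0 := by
  rw [← ncard_norm_eq_and_dvd (Fact.out : p.Prime).pos]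
  refine congrArg Set.ncard (Set.ext fun z => ⟨fun hz => ⟨hz, ?_⟩, fun hz => hz.1⟩)
  rw [Zsqrtd.intCast_dvd]
  refine legendreSym.prime_dvd_of_eq_neg_one h ⟨m, ?_⟩
  rw [Set.mem_ofPred_eq, norm_eq_sq_add] at hz
  push_cast at hz
  linarith

theorem exists_small_mul_eq {p : ℕ} [Fact p.Prime] (t : ZMod p) :
    ∃ y z : ℤ, (y ≠ 0 ∨ z ≠ 0) ∧ y ^ 2 < p ∧ z ^ 2 < p ∧ (y : ZMod p) = t * z := by
  have hp : p.Prime := Fact.out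
  set s := p.sqrt with hs
  have h1 : p < (s + 1) * (s + 1) := Nat.lt_succ_sqrt p
  have h2 : (s : ℤ) ^ 2 < p := by
    have h3 : s * s ≤ p := Nat.sqrt_le p
    have h4 : s * s ≠ p := fun h => (Nat.prime_iff.1 hp).not_isSquare ⟨s, h.symm⟩
    have h5 : s * s < p := lt_of_le_of_ne h3 h4
    rw [sq]
    exact_mod_cast h5
  obtain ⟨⟨a, b⟩, hab, ⟨c, d⟩, hcd, hne, heq⟩ :=
    exists_ne_map_eq_of_card_lt_of_maps_to
      (s := range (s + 1) ×ˢ range (s + 1)) (t := (univ : Finset (ZMod p)))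
      (f := fun q => (q.1 : ZMod p) - t * q.2) (by simpa [ZMod.card] using h1)
      (fun _ _ => mem_univ _)
  simp only [mem_product, mem_range] at hab hcd
  refine ⟨a - c, b - d, ?_, ?_, ?_, ?_⟩
  · by_contra! h
    apply hne
    ext <;> simp only <;> omega
  · refine lt_of_le_of_lt (sq_le_sq' ?_ ?_) h2 <;> omega
  · refine lt_of_le_of_lt (sq_le_sq' ?_ ?_) h2 <;> omega
  · push_cast
    linear_combination heq

theorem exists_norm_eq_prime {p : ℕ} [Fact p.Prime] (hp2 : p ≠ 2)
    (h : legendreSym p (-3) = 1) : ∃ w : ℤ√(-3), w.norm = p := by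
  have hp : p.Prime := Fact.out
  have hodd := hp.odd_of_ne_two hp2
  have h3 : ((-3 : ℤ) : ZMod p) ≠ 0 := by
    intro h0
    rw [(legendreSym.eq_zero_iff p (-3)).2 h0] at h
    norm_num at h
  obtain ⟨t, ht⟩ := (legendreSym.eq_one_iff p h3).1 h
  obtain ⟨y, z, hyz, hy, hz, e⟩ := exists_small_mul_eq t
  have hd : (p : ℤ) ∣ y ^ 2 + 3 * z ^ 2 := by
    rw [← ZMod.intCast_zmod_eq_zero_iff_dvd]
    push_cast at ht ⊢
    rw [e]
    linear_combination -(z : ZMod p) ^ 2 * ht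
  obtain ⟨k, hk⟩ := hd
  have hp0 : (0 : ℤ) < p := by exact_mod_cast hp.pos
  have hpos : 0 < y ^ 2 + 3 * z ^ 2 := by
    rcases hyz with h | h <;> positivity
  have hk0 : 0 < k := by
    rw [hk] at hpos
    exact pos_of_mul_pos_right hpos hp0.le
  have hk4 : k < 4 := by nlinarith
  interval_cases k
  · exact ⟨⟨y, z⟩, by rw [norm_eq_sq_add]; linarith⟩
  · refine absurd ?_ (norm_ne_two_mul_odd ⟨y, z⟩ (m := p) (by exact_mod_cast hodd))
    rw [norm_eq_sq_add]; linarith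
  · obtain ⟨x, rfl⟩ : (3 : ℤ) ∣ y :=
      Int.prime_three.dvd_of_dvd_pow (n := 2) ⟨p - z ^ 2, by linarith⟩
    exact ⟨⟨z, x⟩, by rw [norm_eq_sq_add]; linarith⟩

theorem not_dvd_of_norm_eq_prime {p : ℕ} (hp : p.Prime) (hp3 : p ≠ 3) {w : ℤ√(-3)}
    (hw : w.norm = p) : ¬ (p : ℤ) ∣ w.re ∧ ¬ (p : ℤ) ∣ w.im := by
  have hp' : Prime (p : ℤ) := Nat.prime_iff_prime_int.1 hp
  rw [norm_eq_sq_add] at hw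
  have both : ¬ ((p : ℤ) ∣ w.re ∧ (p : ℤ) ∣ w.im) := by
    rintro ⟨⟨a, ha⟩, b, hb⟩
    rw [ha, hb] at hw
    have h1 : (p : ℤ) * (p * (a ^ 2 + 3 * b ^ 2)) = p * 1 := by linarith
    exact hp'.not_isUnit (IsUnit.of_mul_eq_one _ (mul_left_cancel₀ hp'.ne_zero h1))
  have h3 : ¬ (p : ℤ) ∣ 3 := fun h =>
    hp3 ((Nat.prime_dvd_prime_iff_eq hp Nat.prime_three).1 (by exact_mod_cast h))
  constructor <;> rintro ⟨k, hk⟩ <;> apply both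
  · have : (p : ℤ) ∣ 3 * w.im ^ 2 := ⟨1 - p * k ^ 2, by rw [hk] at hw; linarith⟩
    exact ⟨⟨k, hk⟩, hp'.dvd_of_dvd_pow ((hp'.dvd_or_dvd this).resolve_left h3)⟩
  · have : (p : ℤ) ∣ w.re ^ 2 := ⟨1 - 3 * p * k ^ 2, by rw [hk] at hw; linarith⟩
    exact ⟨hp'.dvd_of_dvd_pow this, ⟨k, hk⟩⟩

theorem dvd_iff_prime_dvd {p : ℕ} (hp : p.Prime) (hp3 : p ≠ 3) {w z : ℤ√(-3)} (hw : w.norm = p)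
    (hz : (p : ℤ) ∣ z.norm) : w ∣ z ↔ (p : ℤ) ∣ w.re * z.im - w.im * z.re := by
  have hp' : Prime (p : ℤ) := Nat.prime_iff_prime_int.1 hp
  have hws : star w * w = (p : ℤ) := by rw [mul_comm, ← Zsqrtd.norm_eq_mul_conj, hw]
  constructor
  · rintro ⟨y, rfl⟩
    refine ⟨y.im, ?_⟩
    rw [norm_eq_sq_add] at hw
    rw [← hw, Zsqrtd.re_mul, Zsqrtd.im_mul]
    ring
  · intro h
    have hns := not_dvd_of_norm_eq_prime hp hp3 hw
    have h2 : (p : ℤ) ∣ w.re * z.re + 3 * w.im * z.im := by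
      refine (hp'.dvd_or_dvd ?_).resolve_left hns.2
      have : w.im * (w.re * z.re + 3 * w.im * z.im) =
          w.norm * z.im - w.re * (w.re * z.im - w.im * z.re) := by
        rw [norm_eq_sq_add]; ring
      rw [this, hw]
      exact dvd_sub (Dvd.intro _ rfl) (Dvd.dvd.mul_left h _)
    have h3 : ((p : ℤ) : ℤ√(-3)) ∣ star w * z := by
      rw [Zsqrtd.intCast_dvd]
      constructor
      · rw [Zsqrtd.re_mul]
        convert h2 using 1
        simp
      · rw [Zsqrtd.im_mul]
        convert h using 1
        simp
        ring
    obtain ⟨y, hy⟩ := h3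
    rw [← hws, mul_assoc] at hy
    refine ⟨y, mul_left_injective_of_norm_ne_zero (w := star w) ?_ hy⟩
    rw [Zsqrtd.norm_conj, hw]
    exact hp'.ne_zero

theorem normCount_split {p : ℕ} (hp : p.Prime) (hp2 : p ≠ 2) (hp3 : p ≠ 3) {w : ℤ√(-3)}
    (hw : w.norm = p) (m : ℕ) :
    normCount (p * m : ℕ) + (if p ∣ m then normCount (m / p : ℕ) else 0) = 2 * normCount m := by
  have hp' : Prime (p : ℤ) := Nat.prime_iff_prime_int.1 hp
  have hw' : (star w).norm = p := by rw [Zsqrtd.norm_conj, hw]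
  have hns := not_dvd_of_norm_eq_prime hp hp3 hw
  have hws : w * star w = (p : ℤ) := by rw [← Zsqrtd.norm_eq_mul_conj, hw]
  have h2 : ¬ (p : ℤ) ∣ 2 := fun h =>
    hp2 ((Nat.prime_dvd_prime_iff_eq hp Nat.prime_two).1 (by exact_mod_cast h))
  have image_eq {v : ℤ√(-3)} (hv : v.norm = p) : (fun z => v * z) '' {z : ℤ√(-3) | z.norm = m} =
      {z : ℤ√(-3) | z.norm = (p * m : ℕ) ∧ v ∣ z} := by
    ext z
    constructor
    · rintro ⟨y, hy, rfl⟩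
      rw [Set.mem_ofPred_eq] at hy
      refine ⟨?_, Dvd.intro _ rfl⟩
      rw [Zsqrtd.norm_mul, hv, hy]
      push_cast
      rfl
    · rintro ⟨hz, y, rfl⟩
      refine ⟨y, ?_, rfl⟩
      rw [Zsqrtd.norm_mul, hv, Nat.cast_mul] at hz
      exact mul_left_cancel₀ hp'.ne_zero hz
  have hdvd {z : ℤ√(-3)} (hz : z.norm = (p * m : ℕ)) : (p : ℤ) ∣ z.norm :=
    ⟨m, by rw [hz, Nat.cast_mul]⟩
  have star_iff {z : ℤ√(-3)} (hz : (p : ℤ) ∣ z.norm) :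
      star w ∣ z ↔ (p : ℤ) ∣ w.re * z.im + w.im * z.re := by
    rw [dvd_iff_prime_dvd hp hp3 hw' hz]
    simp
  have hfin (v : ℤ√(-3)) : {z : ℤ√(-3) | z.norm = (p * m : ℕ) ∧ v ∣ z}.Finite :=
    (finite_norm_eq _).subset fun z hz => hz.1
  have hunion : {z : ℤ√(-3) | z.norm = (p * m : ℕ) ∧ w ∣ z} ∪
      {z : ℤ√(-3) | z.norm = (p * m : ℕ) ∧ star w ∣ z} = {z : ℤ√(-3) | z.norm = (p * m : ℕ)} := by
    ext z
    constructor
    · rintro (h | h) <;> exact h.1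
    · intro hz
      have hd := hdvd hz
      have : (p : ℤ) ∣ (w.re * z.im - w.im * z.re) * (w.re * z.im + w.im * z.re) := by
        have e : (w.re * z.im - w.im * z.re) * (w.re * z.im + w.im * z.re) =
            w.norm * z.im ^ 2 - w.im ^ 2 * z.norm := by
          rw [norm_eq_sq_add, norm_eq_sq_add]; ring
        rw [e, hw]
        exact dvd_sub (Dvd.intro _ rfl) (Dvd.dvd.mul_left hd _)
      rcases hp'.dvd_or_dvd this with h | h
      · exact Or.inl ⟨hz, (dvd_iff_prime_dvd hp hp3 hw hd).2 h⟩
      · exact Or.inr ⟨hz, (star_iff hd).2 h⟩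
  have hinter : {z : ℤ√(-3) | z.norm = (p * m : ℕ) ∧ w ∣ z} ∩
      {z : ℤ√(-3) | z.norm = (p * m : ℕ) ∧ star w ∣ z} =
        {z : ℤ√(-3) | z.norm = (p * m : ℕ) ∧ ((p : ℤ) : ℤ√(-3)) ∣ z} := by
    ext z
    constructor
    · rintro ⟨⟨hz, h⟩, -, h'⟩
      have hd := hdvd hz
      rw [dvd_iff_prime_dvd hp hp3 hw hd] at h
      rw [star_iff hd] at h'
      refine ⟨hz, (Zsqrtd.intCast_dvd _ _).2 ⟨?_, ?_⟩⟩
      · have := dvd_sub h' h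
        rw [show w.re * z.im + w.im * z.re - (w.re * z.im - w.im * z.re) =
          2 * (w.im * z.re) by ring] at this
        exact (hp'.dvd_or_dvd ((hp'.dvd_or_dvd this).resolve_left h2)).resolve_left hns.2
      · have := dvd_add h' h
        rw [show w.re * z.im + w.im * z.re + (w.re * z.im - w.im * z.re) =
          2 * (w.re * z.im) by ring] at this
        exact (hp'.dvd_or_dvd ((hp'.dvd_or_dvd this).resolve_left h2)).resolve_left hns.1
    · rintro ⟨hz, h⟩
      rw [← hws] at h
      exact ⟨⟨hz, (Dvd.intro _ rfl).trans h⟩, hz, (Dvd.intro_left _ rfl).trans h⟩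
  have h := Set.ncard_union_add_ncard_inter _ _ (hfin w) (hfin (star w))
  have hp0 : (p : ℤ) ≠ 0 := hp'.ne_zero
  rw [hunion, hinter, ncard_norm_eq_and_dvd hp.pos, ← image_eq hw, ← image_eq hw',
    ncard_image_mul (by rwa [hw]), ncard_image_mul (by rwa [hw'])] at h
  rw [two_mul, ← h]
  rfl

theorem normCount_prime_mul {p : ℕ} (hp : p.Prime) (hp2 : p ≠ 2) (m : ℕ) :
    (normCount (p * m : ℕ) : ℤ) = (1 + chiThree p) * normCount m -
      chiThree p * if p ∣ m then (normCount (m / p : ℕ) : ℤ) else 0 := by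
  have : Fact p.Prime := ⟨hp⟩
  rcases eq_or_ne p 3 with rfl | hp3
  · rw [chiThree_of_mod_zero rfl, Nat.cast_mul]
    simp [normCount_three_mul]
  have hl : legendreSym p (-3) = chiThree p := by
    rw [jacobiSym.legendreSym.to_jacobiSym, jacobiSym_neg_three (hp.odd_of_ne_two hp2)]
  have h0 : p % 3 ≠ 0 := fun h =>
    hp3 ((Nat.prime_dvd_prime_iff_eq Nat.prime_three hp).1 (Nat.dvd_of_mod_eq_zero h)).symm
  have : p % 3 = 1 ∨ p % 3 = 2 := by omega
  rcases this with h | h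
  · rw [chiThree_of_mod_one h] at hl ⊢
    obtain ⟨w, hw⟩ := exists_norm_eq_prime hp2 hl
    have := congrArg (Nat.cast : ℕ → ℤ) (normCount_split hp hp2 hp3 hw m)
    push_cast at this ⊢
    linarith
  · rw [chiThree_of_mod_two h] at hl ⊢
    rw [normCount_inert hl]
    split_ifs <;> simp

theorem normCount_eq (n : ℕ) (hn : 0 < n) :
    (normCount n : ℤ) = (if Even n then 6 else 2) * tauThree n := by
  induction n using Nat.strong_induction_on with
  | _ n ih =>
    rcases Nat.eq_two_pow_or_exists_odd_prime_and_dvd n with ⟨k, rfl⟩ | ⟨p, hp, ⟨m, rfl⟩, hodd⟩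
    · match k with
      | 0 => simp [normCount_one, tauThree_one]
      | 1 =>
        have h1 : normCount 2 = 0 := by
          rw [normCount, Set.ncard_eq_zero (finite_norm_eq _), Set.eq_empty_iff_forall_notMem]
          exact fun z hz => norm_ne_two_mul_odd z (m := 1) odd_one hz
        have h2 : tauThree 2 = 0 := by
          rw [tauThree, Nat.prime_two.sum_divisors, chiThree_one, chiThree_of_mod_two rfl]
          rfl
        simp [h1, h2]
      | 2 =>
        have h := tauThree_four_mul one_pos
        rw [mul_one, tauThree_one] at h
        norm_num [h, normCount_four]
      | k + 3 =>
        have h := ih (2 ^ (k + 1)) (Nat.pow_lt_pow_right one_lt_two (by omega)) (by positivity)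
        have e : normCount (2 ^ (k + 3) : ℕ) = normCount (2 ^ (k + 1) : ℕ) := by
          have := normCount_eight_mul (2 ^ k)
          push_cast
          rwa [show (8 : ℤ) * 2 ^ k = 2 ^ (k + 3) by ring,
            show (2 : ℤ) * 2 ^ k = 2 ^ (k + 1) by ring] at this
        have e' : tauThree (2 ^ (k + 3)) = tauThree (2 ^ (k + 1)) := by
          rw [← tauThree_four_mul (m := 2 ^ (k + 1)) (by positivity)]
          congr 1
          ring
        rw [e, e', h]
        simp [Nat.even_pow]
    · have hm : 0 < m := Nat.pos_of_mul_pos_left hn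
      have hlt : m < p * m := lt_mul_of_one_lt_left hm hp.one_lt
      have he : Even (p * m) ↔ Even m := by
        rw [Nat.even_mul, or_iff_right (Nat.not_even_iff_odd.2 hodd)]
      have hp2 : p ≠ 2 := by
        rintro rfl
        exact absurd hodd (by decide)
      rw [normCount_prime_mul hp hp2, tauThree_prime_mul hp hm, ih m hlt hm]
      by_cases hd : p ∣ m
      · obtain ⟨l, rfl⟩ := hd
        have hl : 0 < l := Nat.pos_of_mul_pos_left hm
        have he' : Even (p * l) ↔ Even l := by
          rw [Nat.even_mul, or_iff_right (Nat.not_even_iff_odd.2 hodd)]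
        have := ih l ((lt_mul_of_one_lt_left hl hp.one_lt).trans hlt) hl
        rw [if_pos (Dvd.intro _ rfl), if_pos (Dvd.intro _ rfl),
          Nat.mul_div_cancel_left _ hp.pos, this]
        simp only [he, he']
        ring
      · rw [if_neg hd, if_neg hd]
        simp only [he]
        ring

theorem tRep_sq_eq_sum (n : ℕ) :
    tRep 1 1 3 ((n : ℤ) ^ 2) =
      ∑ a ∈ range (2 * n + 1), normCount (a * (2 * n - a) : ℕ) := by
  classical
  let s : Finset (Σ _ : ℕ, ℤ√(-3)) := (range (2 * n + 1)).sigma fun a =>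
    (finite_norm_eq (a * (2 * n - a) : ℕ)).toFinset
  let f : (Σ _ : ℕ, ℤ√(-3)) → ℤ × ℤ × ℤ := fun x => ((x.1 : ℤ) - n, x.2.re, x.2.im)
  have hf : Function.Injective f := by
    rintro ⟨a, z⟩ ⟨b, w⟩ h
    simp only [f, Prod.mk.injEq, sub_left_inj, Nat.cast_inj] at h
    obtain ⟨rfl, h1, h2⟩ := h
    rw [Zsqrtd.ext h1 h2]
  have hs : {v : ℤ × ℤ × ℤ | tVal 1 1 3 v = (n : ℤ) ^ 2} = f '' s := by
    ext ⟨x, y, z⟩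
    simp only [Set.mem_ofPred_eq, tVal, Set.mem_image, Finset.mem_coe]
    constructor
    · intro h
      have hx : |x| ≤ n := abs_le_of_sq_le_sq (by nlinarith [sq_nonneg y, sq_nonneg z]) (by positivity)
      obtain ⟨h1, h2⟩ := abs_le.1 hx
      obtain ⟨a, ha⟩ := Int.eq_ofNat_of_zero_le (show 0 ≤ x + n by linarith)
      refine ⟨⟨a, ⟨y, z⟩⟩, ?_, ?_⟩
      · have hle : a ≤ 2 * n := by omega
        simp only [s, Finset.mem_sigma, Finset.mem_range, Set.Finite.mem_toFinset,
          Set.mem_ofPred_eq, norm_eq_sq_add]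
        refine ⟨by omega, ?_⟩
        rw [Nat.cast_mul, Nat.cast_sub hle, ← ha]
        push_cast
        linarith
      · simp [f, ← ha]
    · rintro ⟨⟨a, w⟩, hw, h⟩
      simp only [s, Finset.mem_sigma, Finset.mem_range, Set.Finite.mem_toFinset,
        Set.mem_ofPred_eq, norm_eq_sq_add] at hw
      simp only [f, Prod.mk.injEq] at h
      obtain ⟨rfl, rfl, rfl⟩ := h
      have hle : a ≤ 2 * n := by omega
      have := hw.2
      rw [Nat.cast_mul, Nat.cast_sub hle] at this
      push_cast at this
      linarith
  rw [tRep, hs, Set.ncard_image_of_injective _ hf, Set.ncard_coe_finset, Finset.card_sigma]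
  exact Finset.sum_congr rfl fun a _ => (Set.ncard_eq_toFinset_card _ _).symm

theorem sum_even_tauThree (n : ℕ) :
    ∑ a ∈ (Ioo 0 (2 * n)).filter Even, tauThree (a * (2 * n - a)) = mulSum n := by
  refine (Finset.sum_bij' (fun a _ => 2 * a) (fun a _ => a / 2) ?_ ?_ ?_ ?_ ?_).symm
  · intro a ha
    simp only [mem_filter, mem_Ioo, even_two, Even.mul_right, and_true] at ha ⊢
    omega
  · intro a ha
    simp only [mem_filter, mem_Ioo, Nat.even_iff] at ha ⊢
    omega
  · intro a _
    omega
  · intro a ha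
    simp only [mem_filter, mem_Ioo, Nat.even_iff] at ha
    omega
  · intro a ha
    rw [mem_Ioo] at ha
    rw [← tauThree_four_mul (Nat.mul_pos ha.1 (Nat.sub_pos_of_lt ha.2)), ← Nat.mul_sub]
    congr 1
    ring

theorem tRep_sq_eq_mulSum {n : ℕ} (hn : 0 < n) :
    (tRep 1 1 3 ((n : ℤ) ^ 2) : ℤ) = 2 + 2 * mulSum (2 * n) + 4 * mulSum n := by
  have hsplit : ∑ a ∈ range (2 * n + 1), normCount (a * (2 * n - a) : ℕ) =
      2 + ∑ a ∈ Ioo 0 (2 * n), normCount (a * (2 * n - a) : ℕ) := by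
    rw [Finset.sum_range_succ, ← Nat.Ico_zero_eq_range,
      ← Finset.Ioo_insert_left (show 0 < 2 * n by omega), Finset.sum_insert (by simp)]
    simp only [zero_mul, Nat.sub_self, mul_zero, Nat.cast_zero, normCount_zero]
    ring
  rw [tRep_sq_eq_sum, hsplit, Nat.cast_add, Nat.cast_sum]
  have hterm : ∀ a ∈ Ioo 0 (2 * n), (normCount (a * (2 * n - a) : ℕ) : ℤ) =
      2 * tauThree (a * (2 * n - a)) +
        4 * if Even a then tauThree (a * (2 * n - a)) else 0 := by
    intro a ha
    rw [mem_Ioo] at ha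
    rw [normCount_eq _ (Nat.mul_pos ha.1 (Nat.sub_pos_of_lt ha.2))]
    have he : Even (a * (2 * n - a)) ↔ Even a := by
      rw [Nat.even_mul, Nat.even_sub ha.2.le]
      simp
    simp only [he]
    split_ifs <;> ring
  rw [Finset.sum_congr rfl hterm, Finset.sum_add_distrib, ← Finset.mul_sum, ← Finset.mul_sum,
    ← Finset.sum_filter, sum_even_tauThree, mulSum.eq_1 (2 * n)]
  push_cast
  ring

theorem three_mul_tRep_sq {n : ℕ} (hn : 0 < n) :
    3 * (tRep 1 1 3 ((n : ℤ) ^ 2) : ℤ) = 2 * mulSumArith (2 * n) + 4 * mulSumArith n := by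
  have h (m : ℕ) (hm : 0 < m) : mulSumArith m = 1 + 3 * mulSum m := if_neg hm.ne'
  rw [tRep_sq_eq_mulSum hn, h n hn, h (2 * n) (by omega)]
  ring

/-- The ternary form `x² + 1y² + 3z²`-type form `⟨1,1,3⟩` is strongly s-regular. -/
theorem stmt_16 (n₁ n₂ : ℕ) (h₁ : 0 < n₁) (h₂ : 0 < n₂)
    (hfac : ∀ p : ℕ, p.Prime → p ∣ n₁ → p = 2 ∨ p = 3) (hcop : Nat.Coprime n₂ 6) :
    (tRep 1 1 3 (((n₁ : ℤ) * (n₂ : ℤ)) ^ 2) : ℤ) =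
      (tRep 1 1 3 ((n₁ : ℤ) ^ 2) : ℤ) *
        ∏ p ∈ n₂.primeFactors, tHp 1 1 3 p (n₂.factorization p) := by
  have hn : n₁.Coprime n₂ := by
    refine Nat.coprime_of_dvd fun p hp h1 h2 => ?_
    have h6 : p ∣ 6 := by
      rcases hfac p hp h1 with rfl | rfl <;> decide
    exact hp.one_lt.ne' (Nat.eq_one_of_dvd_coprimes hcop h2 h6)
  have h2 : Nat.Coprime 2 n₂ := (Nat.Coprime.coprime_dvd_right (by decide) hcop).symm
  have hmul := isMultiplicative_mulSumArith
  have e₁ := three_mul_tRep_sq h₁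
  have e := three_mul_tRep_sq (Nat.mul_pos h₁ h₂)
  rw [← mul_assoc, hmul.map_mul_of_coprime (h2.mul_left hn), hmul.map_mul_of_coprime hn,
    Nat.cast_mul] at e
  rw [prod_tHp hcop]
  refine mul_left_cancel₀ (three_ne_zero (α := ℤ)) ?_
  rw [e, ← mul_assoc 3, e₁]
  ring
end
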